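/- arXiv:1401.6863 — 8 statements merged into one kernel-verified Lean document; each statement's English description precedes it below -/
import Mathlib

section
/- Let d ≥ 1 and n ≥ 1 be integers and let 0 < α < 1. There exist positive constants A = A(n,d,α) and B = B(n,d,α), depending only on n, d and α, such that for every triple of pairwise distinct points x, y, z ∈ ℝ^d and every coordinate index 1 ≤ i ≤ d one has A · M_i^{2(2n−1)} / L(x,y,z)^{2α+2(2n−1)} ≤ p^i_{α,n}(x,y,z) ≤ B / L(x,y,z)^{2α}. -/
open scoped BigOperators

/-- The kernel `K^i_{α,n}(x) = x_i^{2n-1} / |x|^{2n-1+α}`. -/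
noncomputable def Kker (d n : ℕ) (α : ℝ) (i : Fin d) (x : EuclideanSpace ℝ (Fin d)) : ℝ :=
  (x i) ^ (2 * n - 1) / ‖x‖ ^ (2 * (n : ℝ) - 1 + α)

/-- The symmetrization (permutation) `p^i_{α,n}(x,y,z)`. -/
noncomputable def permI (d n : ℕ) (α : ℝ) (i : Fin d)
    (x y z : EuclideanSpace ℝ (Fin d)) : ℝ :=
  Kker d n α i (x - y) * Kker d n α i (x - z) +
    Kker d n α i (y - x) * Kker d n α i (y - z) +
    Kker d n α i (z - x) * Kker d n α i (z - y)

/-- `L(x,y,z)`: the length of the longest side of the triangle with vertices `x, y, z`. -/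
noncomputable def Ltri (d : ℕ) (x y z : EuclideanSpace ℝ (Fin d)) : ℝ :=
  max ‖x - y‖ (max ‖y - z‖ ‖x - z‖)

/-- A quantitative form of Jensen's inequality for the power `m + α`, with weights `w`, `1 - w`. -/
theorem const_mul_rpow_le_weighted_sub {m : ℕ} (hm : 1 ≤ m) {α : ℝ} (hα0 : 0 < α) (hα1 : α < 1)
    {w a b c μ : ℝ} (hw0 : 0 ≤ w) (hw1 : w ≤ 1) (hμ : 0 ≤ μ) (hc : 0 ≤ c)
    (hμa : μ ≤ a) (hμb : μ ≤ b) (hcab : c ≤ a + b) :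
    (1 / 2 : ℝ) ^ m * (1 - (1 / 2 : ℝ) ^ (1 - α)) * μ ^ (m + α) ≤
      w ^ m * b ^ (m + α) + (1 - w) ^ m * a ^ (m + α) - w ^ m * (1 - w) ^ m * c ^ (m + α) := by
  have hm1 : (1 : ℝ) ≤ m := by exact_mod_cast hm
  have ha : 0 ≤ a := hμ.trans hμa
  have hb : 0 ≤ b := hμ.trans hμb
  have hv0 : 0 ≤ 1 - w := by linarith
  have weight_rpow : ∀ v r : ℝ, 0 < v → 0 ≤ r →
      v ^ m * (v * (r / v) ^ (m + α)) = v ^ (1 - α) * r ^ (m + α) := by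
    intro v r hv hr
    rw [Real.div_rpow hr hv.le, Real.rpow_add hv, Real.rpow_natCast, Real.rpow_sub hv,
      Real.rpow_one]
    have := Real.rpow_pos_of_pos hv α
    field_simp
  have jensen : w ^ m * (1 - w) ^ m * c ^ (m + α) ≤
      (1 - w) ^ m * (w ^ (1 - α) * a ^ (m + α)) + w ^ m * ((1 - w) ^ (1 - α) * b ^ (m + α)) := by
    rcases hw0.eq_or_lt with rfl | hw
    · rw [zero_pow (by omega)]
      simp only [zero_mul, sub_zero, add_zero]
      positivity
    rcases hv0.eq_or_lt with hv | hv
    · rw [← hv, zero_pow (by omega)]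
      simp only [mul_zero, zero_mul, zero_add]
      positivity
    have h := (convexOn_rpow (p := m + α) (by linarith)).2
      (Set.mem_Ici.2 (div_nonneg ha hw0)) (Set.mem_Ici.2 (div_nonneg hb hv0)) hw0 hv0 (by ring)
    simp only [smul_eq_mul] at h
    rw [mul_div_cancel₀ _ hw.ne', mul_div_cancel₀ _ hv.ne'] at h
    have h' : c ^ (m + α) ≤ (a + b) ^ (m + α) := Real.rpow_le_rpow hc hcab (by linarith)
    rw [← weight_rpow w a hw ha, ← weight_rpow (1 - w) b hv hb]
    calc w ^ m * (1 - w) ^ m * c ^ (m + α)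
        ≤ w ^ m * (1 - w) ^ m * (w * (a / w) ^ (m + α) + (1 - w) * (b / (1 - w)) ^ (m + α)) :=
          mul_le_mul_of_nonneg_left (h'.trans h) (by positivity)
      _ = _ := by ring
  have defect : ∀ v r : ℝ, 0 ≤ v → v ≤ 1 → μ ≤ r →
      0 ≤ (1 - v) ^ m * (1 - v ^ (1 - α)) * r ^ (m + α) ∧
      (v ≤ 1 / 2 → (1 / 2 : ℝ) ^ m * (1 - (1 / 2 : ℝ) ^ (1 - α)) * μ ^ (m + α) ≤
        (1 - v) ^ m * (1 - v ^ (1 - α)) * r ^ (m + α)) := by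
    intro v r h0 h1 hr
    have hr0 : 0 ≤ r := hμ.trans hr
    have e1 : 0 ≤ 1 - v := by linarith
    have e2 : 0 ≤ 1 - v ^ (1 - α) :=
      sub_nonneg.2 (Real.rpow_le_one h0 h1 (by linarith))
    refine ⟨by positivity, fun hv => ?_⟩
    have e3 : (0 : ℝ) ≤ 1 - (1 / 2 : ℝ) ^ (1 - α) :=
      sub_nonneg.2 (Real.rpow_le_one (by norm_num) (by norm_num) (by linarith))
    have e4 : v ^ (1 - α) ≤ (1 / 2 : ℝ) ^ (1 - α) := Real.rpow_le_rpow h0 hv (by linarith)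
    have e5 : (1 / 2 : ℝ) ^ m ≤ (1 - v) ^ m :=
      pow_le_pow_left₀ (by norm_num) (by linarith) m
    have e6 : μ ^ (m + α) ≤ r ^ (m + α) := Real.rpow_le_rpow hμ hr (by linarith)
    have e7 : 0 ≤ μ ^ (m + α) := Real.rpow_nonneg hμ _
    exact mul_le_mul (mul_le_mul e5 (by linarith) e3 (by positivity)) e6 e7 (by positivity)
  have dw := defect w a hw0 hw1 hμa
  have dv := defect (1 - w) b hv0 (by linarith) hμb
  rw [sub_sub_cancel] at dv
  rcases le_total w (1 / 2) with h | h
  · have := dw.2 h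
    have := dv.1
    linarith
  · have := dv.2 (by linarith)
    have := dw.1
    linarith

/-- The lower bound for the permutation, in terms of the coordinates and lengths of the sides. -/
theorem const_mul_div_le_perm_scalar {m : ℕ} (hm : 1 ≤ m) {α : ℝ} (hα0 : 0 < α) (hα1 : α < 1)
    {s t a b c l : ℝ} (hs : 0 ≤ s) (ht : 0 ≤ t) (ha : 0 < a) (hb : 0 < b) (hc : 0 < c)
    (hal : a ≤ l) (hbl : b ≤ l) (hcl : c ≤ l) (hcab : c ≤ a + b) :
    (1 / 2 : ℝ) ^ m * (1 - (1 / 2 : ℝ) ^ (1 - α)) * (s + t) ^ (2 * m) /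
        l ^ (2 * (m + α)) ≤
      s ^ m / a ^ (m + α) * ((s + t) ^ m / c ^ (m + α)) -
        s ^ m / a ^ (m + α) * (t ^ m / b ^ (m + α)) +
        (s + t) ^ m / c ^ (m + α) * (t ^ m / b ^ (m + α)) := by
  have hl : 0 < l := ha.trans_le hal
  rcases (add_nonneg hs ht).eq_or_lt with h0 | hst
  · have hs0 : s = 0 := by linarith
    have ht0 : t = 0 := by linarith
    subst hs0 ht0
    simp [show m ≠ 0 by omega]
  have hw1 : s / (s + t) ≤ 1 := (div_le_one hst).2 (by linarith)
  have hw : 1 - s / (s + t) = t / (s + t) := by field_simp; ring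
  have key := const_mul_rpow_le_weighted_sub hm hα0 hα1 (div_nonneg hs hst.le) hw1
    (le_min ha.le hb.le) hc.le (min_le_left a b) (min_le_right a b) hcab
  rw [hw, div_pow s, div_pow t] at key
  have hq : 0 ≤ (m : ℝ) + α := by positivity
  have hmin : a ^ (m + α) * b ^ (m + α) * c ^ (m + α) ≤
      min a b ^ (m + α) * l ^ (2 * (m + α)) := by
    have e : l ^ (2 * (m + α)) = l ^ (m + α) * l ^ (m + α) := by
      rw [two_mul, Real.rpow_add hl]
    rw [e, ← Real.mul_rpow ha.le hb.le, ← min_mul_max a b,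
      Real.mul_rpow (le_min ha.le hb.le) (ha.le.trans (le_max_left a b)), mul_assoc]
    have h1 : max a b ^ (m + α) ≤ l ^ (m + α) :=
      Real.rpow_le_rpow (ha.le.trans (le_max_left a b)) (max_le hal hbl) hq
    have h2 : c ^ (m + α) ≤ l ^ (m + α) := Real.rpow_le_rpow hc.le hcl hq
    gcongr
  have hA := Real.rpow_pos_of_pos ha (m + α)
  have hB := Real.rpow_pos_of_pos hb (m + α)
  have hC := Real.rpow_pos_of_pos hc (m + α)
  have hL := Real.rpow_pos_of_pos hl (2 * (m + α))
  have hk : (0 : ℝ) ≤ (1 / 2 : ℝ) ^ m * (1 - (1 / 2 : ℝ) ^ (1 - α)) :=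
    mul_nonneg (by positivity)
      (sub_nonneg.2 (Real.rpow_le_one (by norm_num) (by norm_num) (by linarith)))
  generalize (1 / 2 : ℝ) ^ m * (1 - (1 / 2 : ℝ) ^ (1 - α)) = k at key hk ⊢
  generalize a ^ (m + α) = A at *
  generalize b ^ (m + α) = B at *
  generalize c ^ (m + α) = C at *
  generalize l ^ (2 * (m + α)) = D at *
  generalize min a b ^ (m + α) = E at *
  calc k * (s + t) ^ (2 * m) / D
      ≤ k * E * (s + t) ^ (2 * m) / (A * B * C) := by
        rw [div_le_div_iff₀ hL (by positivity)]
        calc k * (s + t) ^ (2 * m) * (A * B * C)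
            ≤ k * (s + t) ^ (2 * m) * (E * D) := by gcongr
          _ = _ := by ring
    _ ≤ (s ^ m / (s + t) ^ m * B + t ^ m / (s + t) ^ m * A -
          s ^ m / (s + t) ^ m * (t ^ m / (s + t) ^ m) * C) * (s + t) ^ (2 * m) / (A * B * C) := by
        gcongr
    _ = _ := by
        rw [mul_comm 2 m, pow_mul]
        field_simp
        ring

theorem abs_rpow_sub_rpow_le {q a b : ℝ} (hq : 1 ≤ q) (ha : 0 < a) (ha1 : a ≤ 1)
    (hb : 0 < b) (hb1 : b ≤ 1) : |a ^ q - b ^ q| ≤ q * |a - b| := by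
  wlog hab : b ≤ a generalizing a b
  · rw [abs_sub_comm, abs_sub_comm a b]
    exact this hb hb1 ha ha1 (le_of_not_ge hab)
  rw [abs_of_nonneg (sub_nonneg.2 (Real.rpow_le_rpow hb.le hab (by linarith))),
    abs_of_nonneg (sub_nonneg.2 hab)]
  have h := one_add_mul_self_le_rpow_one_add (s := b / a - 1) (by have := div_pos hb ha; linarith)
    hq
  rw [add_sub_cancel, Real.div_rpow hb.le ha.le, le_div_iff₀ (Real.rpow_pos_of_pos ha q)] at h
  have h1 : a ^ q ≤ a := by
    simpa using Real.rpow_le_rpow_of_exponent_ge ha ha1 hq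
  have h2 : a ^ q * (q * ((a - b) / a)) ≤ a * (q * ((a - b) / a)) :=
    mul_le_mul_of_nonneg_right h1
      (mul_nonneg (by linarith) (div_nonneg (sub_nonneg.2 hab) ha.le))
  have h3 : a * (q * ((a - b) / a)) = q * (a - b) := by field_simp
  have h4 : (1 + q * (b / a - 1)) * a ^ q = a ^ q - a ^ q * (q * ((a - b) / a)) := by
    field_simp
    ring
  linarith

theorem pow_div_rpow_abs_le {m : ℕ} {q s a : ℝ} (hs : |s| ≤ a) (ha1 : a ≤ 1) :
    |s ^ m / a ^ q| ≤ 1 / a ^ q := by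
  have ha : 0 ≤ a := (abs_nonneg s).trans hs
  rw [abs_div, abs_pow, abs_of_nonneg (Real.rpow_nonneg ha q)]
  exact div_le_div_of_nonneg_right (pow_le_one₀ (abs_nonneg s) (hs.trans ha1))
    (Real.rpow_nonneg ha q)

/-- The upper bound for the permutation when the longest side has length at most one and the two
longer sides have length at least one half. -/
theorem perm_scalar_le_of_le_one {m : ℕ} (hm : 1 ≤ m) {α : ℝ} (hα0 : 0 < α) (hα1 : α < 1)
    {v w a b c : ℝ} (ha : 0 < a) (ha1 : a ≤ 1) (hb : 1 / 2 ≤ b) (hb1 : b ≤ 1)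
    (hc : 1 / 2 ≤ c) (hc1 : c ≤ 1) (hu : |w - v| ≤ a) (hv : |v| ≤ b) (hw : |w| ≤ c)
    (hbc : |b - c| ≤ a) :
    (w - v) ^ m / a ^ (m + α) * (w ^ m / c ^ (m + α)) -
        (w - v) ^ m / a ^ (m + α) * (v ^ m / b ^ (m + α)) +
        w ^ m / c ^ (m + α) * (v ^ m / b ^ (m + α)) ≤
      m * 2 ^ (m + α) + (m + α) * (2 ^ (m + α) * 2 ^ (m + α)) + 2 ^ (m + α) * 2 ^ (m + α) := by
  have hm1 : (1 : ℝ) ≤ m := by exact_mod_cast hm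
  have hb0 : 0 < b := by linarith
  have hc0 : 0 < c := by linarith
  have inv_le : ∀ r : ℝ, 1 / 2 ≤ r → 1 / r ^ (m + α) ≤ 2 ^ (m + α) := by
    intro r hr
    have hr0 : 0 < r := by linarith
    rw [one_div, ← Real.inv_rpow hr0.le]
    refine Real.rpow_le_rpow (by positivity) ?_ (by linarith)
    rw [inv_le_comm₀ hr0 (by norm_num)]
    linarith
  have hT : (0 : ℝ) < 2 ^ ((m : ℝ) + α) := by positivity
  have Kv := (pow_div_rpow_abs_le (m := m) (q := m + α) hv hb1).trans (inv_le b hb)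
  have Kw := (pow_div_rpow_abs_le (m := m) (q := m + α) hw hc1).trans (inv_le c hc)
  have Ku : |(w - v) ^ m / a ^ (m + α)| ≤ 1 / a := by
    rw [abs_div, abs_pow, abs_of_pos (Real.rpow_pos_of_pos ha _), Real.rpow_add ha,
      Real.rpow_natCast, div_le_div_iff₀ (by positivity) ha, one_mul]
    have h1 : |w - v| ^ m ≤ a ^ m := pow_le_pow_left₀ (abs_nonneg _) hu m
    have h2 : a ≤ a ^ α := by
      simpa using Real.rpow_le_rpow_of_exponent_ge ha ha1 hα1.le
    exact mul_le_mul h1 h2 ha.le (by positivity)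
  have hpow : |w ^ m - v ^ m| ≤ m * a := by
    have h := abs_pow_sub_pow_le w v m
    have h1 : max |w| |v| ^ (m - 1) ≤ 1 :=
      pow_le_one₀ (le_max_of_le_left (abs_nonneg w)) (max_le (hw.trans hc1) (hv.trans hb1))
    calc |w ^ m - v ^ m| ≤ |w - v| * m * max |w| |v| ^ (m - 1) := h
      _ ≤ a * m * 1 := by gcongr
      _ = m * a := by ring
  have hrpow : |b ^ (m + α) - c ^ (m + α)| ≤ (m + α) * a :=
    (abs_rpow_sub_rpow_le (by linarith) hb0 hb1 hc0 hc1).trans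
      (mul_le_mul_of_nonneg_left hbc (by linarith))
  have hB := Real.rpow_pos_of_pos hb0 (m + α)
  have hC := Real.rpow_pos_of_pos hc0 (m + α)
  have hdiff : |w ^ m / c ^ (m + α) - v ^ m / b ^ (m + α)| ≤
      (m * 2 ^ (m + α) + (m + α) * (2 ^ (m + α) * 2 ^ (m + α))) * a := by
    have e : w ^ m / c ^ (m + α) - v ^ m / b ^ (m + α) =
        (w ^ m - v ^ m) * (1 / c ^ (m + α)) +
          (v ^ m / b ^ (m + α)) * ((b ^ (m + α) - c ^ (m + α)) * (1 / c ^ (m + α))) := by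
      field_simp
      ring
    have hC' : |1 / c ^ (m + α)| ≤ 2 ^ (m + α) := by
      rw [abs_of_pos (by positivity)]
      exact inv_le c hc
    rw [e]
    refine (abs_add_le _ _).trans ?_
    rw [abs_mul, abs_mul, abs_mul]
    calc _ ≤ m * a * 2 ^ (m + α) + 2 ^ (m + α) * ((m + α) * a * 2 ^ (m + α)) := by gcongr
      _ = _ := by ring
  have h1 : (w - v) ^ m / a ^ (m + α) * (w ^ m / c ^ (m + α) - v ^ m / b ^ (m + α)) ≤
      m * 2 ^ (m + α) + (m + α) * (2 ^ (m + α) * 2 ^ (m + α)) := by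
    refine (le_abs_self _).trans ?_
    rw [abs_mul]
    refine (mul_le_mul Ku hdiff (abs_nonneg _) (by positivity)).trans (le_of_eq ?_)
    field_simp
  have h2 : w ^ m / c ^ (m + α) * (v ^ m / b ^ (m + α)) ≤ 2 ^ (m + α) * 2 ^ (m + α) := by
    refine (le_abs_self _).trans ?_
    rw [abs_mul]
    exact mul_le_mul Kw Kv (abs_nonneg _) hT.le
  linarith

theorem pow_div_rpow_eq_rescale (m : ℕ) (α s : ℝ) {a l : ℝ} (ha : 0 < a) (hl : 0 < l) :
    s ^ m / a ^ (m + α) = (1 / l ^ α) * ((s / l) ^ m / (a / l) ^ (m + α)) := by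
  have := Real.rpow_pos_of_pos hl α
  have := Real.rpow_pos_of_pos ha (m + α)
  rw [Real.div_rpow ha.le hl.le, div_pow, Real.rpow_add hl, Real.rpow_natCast]
  field_simp

/-- The upper bound for the permutation, in terms of the coordinates and lengths of the sides, the
side of length `a` being the shortest one. -/
theorem perm_scalar_le {m : ℕ} (hm : 1 ≤ m) {α : ℝ} (hα0 : 0 < α) (hα1 : α < 1)
    {v w a b c l : ℝ} (ha : 0 < a) (hal : a ≤ l) (hb : l ≤ 2 * b) (hbl : b ≤ l)
    (hc : l ≤ 2 * c) (hcl : c ≤ l) (hu : |w - v| ≤ a) (hv : |v| ≤ b) (hw : |w| ≤ c)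
    (hbc : |b - c| ≤ a) :
    (w - v) ^ m / a ^ (m + α) * (w ^ m / c ^ (m + α)) -
        (w - v) ^ m / a ^ (m + α) * (v ^ m / b ^ (m + α)) +
        w ^ m / c ^ (m + α) * (v ^ m / b ^ (m + α)) ≤
      (m * 2 ^ (m + α) + (m + α) * (2 ^ (m + α) * 2 ^ (m + α)) + 2 ^ (m + α) * 2 ^ (m + α)) /
        l ^ (2 * α) := by
  have hl : 0 < l := ha.trans_le hal
  have hdiv : ∀ r r' : ℝ, |r| ≤ r' → |r / l| ≤ r' / l := by
    intro r r' h
    rw [abs_div, abs_of_pos hl]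
    exact div_le_div_of_nonneg_right h hl.le
  have h := perm_scalar_le_of_le_one hm hα0 hα1 (v := v / l) (w := w / l) (a := a / l)
    (b := b / l) (c := c / l) (div_pos ha hl) ((div_le_one hl).2 hal)
    (by rw [le_div_iff₀ hl]; linarith) ((div_le_one hl).2 hbl)
    (by rw [le_div_iff₀ hl]; linarith) ((div_le_one hl).2 hcl)
    (by rw [← sub_div]; exact hdiv _ _ hu) (hdiv _ _ hv) (hdiv _ _ hw)
    (by rw [← sub_div]; exact hdiv _ _ hbc)
  rw [← sub_div] at h
  rw [pow_div_rpow_eq_rescale m α (w - v) ha hl,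
    pow_div_rpow_eq_rescale m α w (by linarith : 0 < c) hl,
    pow_div_rpow_eq_rescale m α v (by linarith : 0 < b) hl, two_mul α, Real.rpow_add hl]
  have hL := Real.rpow_pos_of_pos hl α
  rw [le_div_iff₀ (by positivity)]
  refine le_trans (le_of_eq ?_) h
  generalize (w / l) ^ m / (c / l) ^ (m + α) = X
  generalize (v / l) ^ m / (b / l) ^ (m + α) = Y
  generalize ((w - v) / l) ^ m / (a / l) ^ (m + α) = Z
  field_simp

section Permutation

variable {d : ℕ}

theorem Kker_neg {n : ℕ} (hn : 1 ≤ n) (α : ℝ) (i : Fin d) (x : EuclideanSpace ℝ (Fin d)) :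
    Kker d n α i (-x) = -Kker d n α i x := by
  have hodd : Odd (2 * n - 1) := ⟨n - 1, by omega⟩
  simp only [Kker, norm_neg, PiLp.neg_apply, hodd.neg_pow, neg_div]

theorem permI_eq {n : ℕ} (hn : 1 ≤ n) (α : ℝ) (i : Fin d) (x y z : EuclideanSpace ℝ (Fin d)) :
    permI d n α i x y z =
      Kker d n α i (x - y) * Kker d n α i (x - z) - Kker d n α i (x - y) * Kker d n α i (y - z) +
        Kker d n α i (x - z) * Kker d n α i (y - z) := by
  rw [permI, ← neg_sub x y, ← neg_sub x z, ← neg_sub y z, Kker_neg hn, Kker_neg hn, Kker_neg hn]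
  ring

theorem permI_swap_left (n : ℕ) (α : ℝ) (i : Fin d) (x y z : EuclideanSpace ℝ (Fin d)) :
    permI d n α i y x z = permI d n α i x y z := by
  simp only [permI]
  ring

theorem permI_swap_right (n : ℕ) (α : ℝ) (i : Fin d) (x y z : EuclideanSpace ℝ (Fin d)) :
    permI d n α i x z y = permI d n α i x y z := by
  simp only [permI]
  ring

theorem Ltri_swap_left (x y z : EuclideanSpace ℝ (Fin d)) : Ltri d y x z = Ltri d x y z := by
  rw [Ltri, Ltri, norm_sub_rev y x, max_comm ‖x - z‖]

theorem Ltri_swap_right (x y z : EuclideanSpace ℝ (Fin d)) : Ltri d x z y = Ltri d x y z := by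
  rw [Ltri, Ltri, norm_sub_rev z y, max_comm ‖y - z‖, max_left_comm, max_comm ‖y - z‖]

theorem abs_apply_sub_le_norm (i : Fin d) (x y : EuclideanSpace ℝ (Fin d)) :
    |x i - y i| ≤ ‖x - y‖ := by
  simpa using PiLp.norm_apply_le (x - y) i

theorem permI_lower_of_le {n : ℕ} (hn : 1 ≤ n) {α : ℝ} (hα0 : 0 < α) (hα1 : α < 1) (i : Fin d)
    {x y z : EuclideanSpace ℝ (Fin d)} (hxy : x ≠ y) (hyz : y ≠ z) (hxz : x ≠ z)
    (h1 : z i ≤ y i) (h2 : y i ≤ x i) :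
    (1 / 2 : ℝ) ^ (2 * n - 1) * (1 - (1 / 2 : ℝ) ^ (1 - α)) *
        (max |y i - x i| (max |z i - y i| |z i - x i|)) ^ (2 * (2 * n - 1)) /
        (Ltri d x y z) ^ (2 * α + 2 * (2 * (n : ℝ) - 1)) ≤ permI d n α i x y z := by
  have hm : ((2 * n - 1 : ℕ) : ℝ) = 2 * n - 1 := by
    rw [Nat.cast_sub (by omega)]
    push_cast
    ring
  have hM : max |y i - x i| (max |z i - y i| |z i - x i|) = (x i - y i) + (y i - z i) := by
    rw [abs_sub_comm (y i), abs_sub_comm (z i), abs_sub_comm (z i),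
      abs_of_nonneg (by linarith : 0 ≤ x i - y i), abs_of_nonneg (by linarith : 0 ≤ y i - z i),
      abs_of_nonneg (by linarith : 0 ≤ x i - z i), max_eq_right (by linarith : y i - z i ≤ x i - z i),
      max_eq_right (by linarith)]
    ring
  have h := const_mul_div_le_perm_scalar (m := 2 * n - 1) (by omega) hα0 hα1
    (sub_nonneg.2 h2) (sub_nonneg.2 h1)
    (norm_sub_pos_iff.2 hxy) (norm_sub_pos_iff.2 hyz) (norm_sub_pos_iff.2 hxz)
    (l := Ltri d x y z) (le_max_left _ _)
    ((le_max_left _ _).trans (le_max_right _ _)) ((le_max_right _ _).trans (le_max_right _ _))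
    (norm_sub_le_norm_sub_add_norm_sub x y z)
  rw [hM, permI_eq hn, show 2 * α + 2 * (2 * (n : ℝ) - 1) = 2 * (((2 * n - 1 : ℕ) : ℝ) + α) by
    rw [hm]; ring]
  simp only [Kker, PiLp.sub_apply, ← hm]
  rwa [sub_add_sub_cancel] at h ⊢

theorem permI_upper_of_le {n : ℕ} (hn : 1 ≤ n) {α : ℝ} (hα0 : 0 < α) (hα1 : α < 1) (i : Fin d)
    {x y z : EuclideanSpace ℝ (Fin d)} (hxy : x ≠ y)
    (h1 : ‖x - y‖ ≤ ‖y - z‖) (h2 : ‖x - y‖ ≤ ‖x - z‖) :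
    permI d n α i x y z ≤
      ((2 * n - 1 : ℕ) * (2 : ℝ) ^ ((2 * n - 1 : ℕ) + α) +
        ((2 * n - 1 : ℕ) + α) * (2 ^ ((2 * n - 1 : ℕ) + α) * 2 ^ ((2 * n - 1 : ℕ) + α)) +
        2 ^ ((2 * n - 1 : ℕ) + α) * 2 ^ ((2 * n - 1 : ℕ) + α)) / (Ltri d x y z) ^ (2 * α) := by
  have hm : ((2 * n - 1 : ℕ) : ℝ) = 2 * n - 1 := by
    rw [Nat.cast_sub (by omega)]
    push_cast
    ring
  have t1 := norm_sub_le_norm_sub_add_norm_sub x y z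
  have t2 := norm_sub_le_norm_sub_add_norm_sub y x z
  rw [norm_sub_rev y x] at t2
  have h := perm_scalar_le (m := 2 * n - 1) (by omega) hα0 hα1 (v := y i - z i) (w := x i - z i)
    (norm_sub_pos_iff.2 hxy) (l := Ltri d x y z) (b := ‖y - z‖) (c := ‖x - z‖) (le_max_left _ _)
    (by simp only [Ltri, max_le_iff]; refine ⟨?_, ?_, ?_⟩ <;> linarith [norm_nonneg (x - y)])
    ((le_max_left _ _).trans (le_max_right _ _))
    (by simp only [Ltri, max_le_iff]; refine ⟨?_, ?_, ?_⟩ <;> linarith [norm_nonneg (x - y)])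
    ((le_max_right _ _).trans (le_max_right _ _))
    (by rw [sub_sub_sub_cancel_right]; exact abs_apply_sub_le_norm i x y)
    (abs_apply_sub_le_norm i y z) (abs_apply_sub_le_norm i x z)
    (by rw [abs_le]; constructor <;> linarith)
  rw [permI_eq hn]
  simp only [Kker, PiLp.sub_apply, ← hm]
  rwa [sub_sub_sub_cancel_right] at h

/-- A symmetric property of triples of points holds as soon as it holds for triples with decreasing
`i`-th coordinates. -/
theorem of_swap_of_apply_le (i : Fin d)
    (P : EuclideanSpace ℝ (Fin d) → EuclideanSpace ℝ (Fin d) → EuclideanSpace ℝ (Fin d) → Prop)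
    (hl : ∀ x y z, P y x z → P x y z) (hr : ∀ x y z, P x z y → P x y z)
    (h : ∀ x y z, z i ≤ y i → y i ≤ x i → P x y z) (x y z : EuclideanSpace ℝ (Fin d)) :
    P x y z := by
  have h' : ∀ x y z, y i ≤ x i → P x y z := by
    intro x y z hyx
    rcases le_total (z i) (y i) with hzy | hyz
    · exact h x y z hzy hyx
    rcases le_total (z i) (x i) with hzx | hxz
    · exact hr _ _ _ (h x z y hyz hzx)
    · exact hr _ _ _ (hl _ _ _ (h z x y hyx hxz))
  rcases le_total (y i) (x i) with hyx | hxy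
  · exact h' x y z hyx
  · exact hl _ _ _ (h' y x z hxy)

/-- A symmetric property of triples of points holds as soon as it holds for triples whose shortest
side joins the first two points. -/
theorem of_swap_of_norm_le
    (P : EuclideanSpace ℝ (Fin d) → EuclideanSpace ℝ (Fin d) → EuclideanSpace ℝ (Fin d) → Prop)
    (hl : ∀ x y z, P y x z → P x y z) (hr : ∀ x y z, P x z y → P x y z)
    (h : ∀ x y z, ‖x - y‖ ≤ ‖y - z‖ → ‖x - y‖ ≤ ‖x - z‖ → P x y z)
    (x y z : EuclideanSpace ℝ (Fin d)) : P x y z := by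
  have h' : ∀ x y z, ‖x - y‖ ≤ ‖x - z‖ → P x y z := by
    intro x y z hxy
    rcases le_total ‖x - y‖ ‖y - z‖ with h1 | h1
    · exact h x y z h1 hxy
    · refine hl _ _ _ (hr _ _ _ (h y z x ?_ ?_))
      · rw [norm_sub_rev z x]
        exact h1.trans hxy
      · rwa [norm_sub_rev y x]
  rcases le_total ‖x - y‖ ‖x - z‖ with h1 | h1
  · exact h' x y z h1
  · exact hr _ _ _ (h' x z y h1)

end Permutation

/-- Proposition: for `0 < α < 1` there are positive constants `A, B` depending only on
`n, d, α` such that for all pairwise distinct `x, y, z ∈ ℝ^d` and every coordinate `i`,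
`A · M_i^{2(2n-1)} / L(x,y,z)^{2α+2(2n-1)} ≤ p^i_{α,n}(x,y,z) ≤ B / L(x,y,z)^{2α}`. -/
theorem stmt0 (d n : ℕ) (hd : 1 ≤ d) (hn : 1 ≤ n) (α : ℝ) (hα0 : 0 < α) (hα1 : α < 1) :
    ∃ A B : ℝ, 0 < A ∧ 0 < B ∧
      ∀ (x y z : EuclideanSpace ℝ (Fin d)) (i : Fin d),
        x ≠ y → y ≠ z → x ≠ z →
        A * (max |y i - x i| (max |z i - y i| |z i - x i|)) ^ (2 * (2 * n - 1)) /
            (Ltri d x y z) ^ (2 * α + 2 * (2 * (n : ℝ) - 1)) ≤ permI d n α i x y z ∧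
          permI d n α i x y z ≤ B / (Ltri d x y z) ^ (2 * α) := by
  have hk : (0 : ℝ) < 1 - (1 / 2 : ℝ) ^ (1 - α) :=
    sub_pos.2 (Real.rpow_lt_one (by norm_num) (by norm_num) (by linarith))
  refine ⟨_, _, mul_pos (by positivity : (0 : ℝ) < (1 / 2 : ℝ) ^ (2 * n - 1)) hk,
    (by positivity : (0 : ℝ) < (2 * n - 1 : ℕ) * (2 : ℝ) ^ ((2 * n - 1 : ℕ) + α) +
        ((2 * n - 1 : ℕ) + α) * (2 ^ ((2 * n - 1 : ℕ) + α) * 2 ^ ((2 * n - 1 : ℕ) + α)) +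
        2 ^ ((2 * n - 1 : ℕ) + α) * 2 ^ ((2 * n - 1 : ℕ) + α)), ?_⟩
  intro x y z i hxy hyz hxz
  constructor
  · revert hxy hyz hxz
    refine of_swap_of_apply_le i (fun x y z => x ≠ y → y ≠ z → x ≠ z → _ * (max |y i - x i|
      (max |z i - y i| |z i - x i|)) ^ (2 * (2 * n - 1)) / (Ltri d x y z) ^ _ ≤
      permI d n α i x y z) ?_ ?_ ?_ x y z
    · intro x y z h hxy hyz hxz
      rw [permI_swap_left, Ltri_swap_left, abs_sub_comm (x i), max_comm |z i - x i|] at h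
      exact h hxy.symm hxz hyz
    · intro x y z h hxy hyz hxz
      rw [permI_swap_right, Ltri_swap_right, abs_sub_comm (y i) (z i), max_comm |z i - y i|,
        max_left_comm, max_comm |z i - x i|] at h
      exact h hxz hyz.symm hxy
    · intro x y z h1 h2 hxy hyz hxz
      exact permI_lower_of_le hn hα0 hα1 i hxy hyz hxz h1 h2
  · revert hxy hyz hxz
    refine of_swap_of_norm_le (fun x y z => x ≠ y → y ≠ z → x ≠ z →
      permI d n α i x y z ≤ _ / (Ltri d x y z) ^ _) ?_ ?_ ?_ x y z
    · intro x y z h hxy hyz hxz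
      rw [permI_swap_left, Ltri_swap_left] at h
      exact h hxy.symm hxz hyz
    · intro x y z h hxy hyz hxz
      rw [permI_swap_right, Ltri_swap_right] at h
      exact h hxz hyz.symm hxy
    · intro x y z h1 h2 hxy hyz hxz
      exact permI_upper_of_le hn hα0 hα1 i hxy h1 h2
end

section
/- Let d ≥ 1 and n ≥ 1 be integers. There is a constant C = C(n) > 0 such that the following holds: for any three pairwise distinct, non-collinear points x, y, z ∈ ℝ^d, setting a = y − x and b = z − y, if |a| ≤ |b| ≤ |a+b| then for every coordinate index 1 ≤ i ≤ d one has p^i_{1,n}(x,y,z) ≥ C · (b_i/|b|)^{2(2n−1)} · c(x,y,z)², where c(x,y,z) is the Menger curvature of x, y, z. -/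
open scoped BigOperators

/-- The Menger curvature of three affinely independent points: the reciprocal of the
circumradius of the triangle they determine. -/
noncomputable def menger (d : ℕ) (x y z : EuclideanSpace ℝ (Fin d))
    (h : AffineIndependent ℝ ![x, y, z]) : ℝ :=
  1 / (Affine.Simplex.circumradius (⟨![x, y, z], h⟩ :
        Affine.Simplex ℝ (EuclideanSpace ℝ (Fin d)) 2))

/-- A two-term Radon inequality. -/
lemma one_add_pow_succ_mul_pow_le (m : ℕ) {r t : ℝ} (hr : 0 ≤ r) (ht : 0 < t) :
    (1 + r) ^ (m + 1) * t ^ m ≤ (1 + t) ^ m * (t ^ m + r ^ (m + 1)) := by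
  have h1t : 0 < 1 + t := by linarith
  have h := (convexOn_pow (𝕜 := ℝ) (m + 1)).2 (Set.mem_Ici.2 zero_le_one)
    (Set.mem_Ici.2 (by positivity : 0 ≤ r / t)) (by positivity : 0 ≤ 1 / (1 + t))
    (by positivity : 0 ≤ t / (1 + t)) (by field_simp)
  simp only [smul_eq_mul, mul_one, one_pow] at h
  have e : 1 / (1 + t) + t / (1 + t) * (r / t) = (1 + r) / (1 + t) := by field_simp
  rw [e] at h
  have h2 := mul_le_mul_of_nonneg_right h (by positivity : 0 ≤ (1 + t) ^ (m + 1) * t ^ m)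
  have e1 : ((1 + r) / (1 + t)) ^ (m + 1) * ((1 + t) ^ (m + 1) * t ^ m)
      = (1 + r) ^ (m + 1) * t ^ m := by
    rw [div_pow]; field_simp
  have e2 : (1 / (1 + t) + t / (1 + t) * (r / t) ^ (m + 1)) * ((1 + t) ^ (m + 1) * t ^ m)
      = (1 + t) ^ m * (t ^ m + r ^ (m + 1)) := by
    rw [div_pow, pow_succ t m, pow_succ (1 + t) m]; field_simp
  rwa [e1, e2] at h2

/-- The chord bound for the convex function `r ↦ (1 + r) ^ m` on `[0, 1]`. -/
lemma one_add_pow_le_chord (m : ℕ) {r : ℝ} (hr : 0 ≤ r) (hr1 : r ≤ 1) :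
    (1 + r) ^ m ≤ 1 + 2 ^ m * r := by
  have h := (convexOn_pow (𝕜 := ℝ) m).2 (Set.mem_Ici.2 zero_le_one)
    (Set.mem_Ici.2 zero_le_two) (sub_nonneg.2 hr1) hr (by ring)
  simp only [smul_eq_mul, mul_one, one_pow] at h
  have e : 1 - r + r * 2 = 1 + r := by ring
  rw [e] at h
  linarith

/-- Bernoulli-type bound `x - y ≤ x ^ (k + 1) - y ^ (k + 1)` for `1 ≤ y ≤ x`. -/
lemma sub_le_pow_succ_sub_pow_succ (k : ℕ) {x y : ℝ} (hy : 1 ≤ y) (hxy : y ≤ x) :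
    x - y ≤ x ^ (k + 1) - y ^ (k + 1) := by
  have h1 : y ^ k ≤ x ^ k := pow_le_pow_left₀ (by linarith) hxy k
  have h2 : 1 ≤ y ^ k := one_le_pow₀ hy
  rw [pow_succ, pow_succ]
  nlinarith [mul_nonneg (sub_nonneg.2 h1) (by linarith : (0 : ℝ) ≤ x),
    mul_nonneg (sub_nonneg.2 h2) (sub_nonneg.2 hxy)]

/-- The normalized numerator of the permutation dominates `(r² - D²) r ^ (2k)`. -/
lemma normalized_numerator_ge (k : ℕ) {r D t : ℝ} (hr : 0 < r) (hr1 : r ≤ 1)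
    (hD : |D| ≤ r) (hS : 0 ≤ r ^ 2 + 2 * D) :
    (r ^ 2 - D ^ 2) * r ^ (2 * k) / (2 * 4 ^ (k + 1)) ≤
      (1 + t) ^ (2 * k + 1) * t ^ (2 * k + 1) + (1 + t) ^ (2 * k + 1) * r ^ (2 * k + 2)
        - t ^ (2 * k + 1) * (1 + r ^ 2 + 2 * D) ^ (k + 1) := by
  obtain ⟨hD1, hD2⟩ := abs_le.1 hD
  have h4 : (1 : ℝ) ≤ 4 ^ (k + 1) := one_le_pow₀ (by norm_num)
  set Q : ℝ := 4 ^ (k + 1) with hQ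
  have hQ2 : Q = 2 ^ (2 * k + 2) := by
    rw [hQ, show 2 * k + 2 = 2 * (k + 1) by ring, pow_mul]; norm_num
  have hlhs : (r ^ 2 - D ^ 2) * r ^ (2 * k) ≤ r ^ (2 * k + 2) := by
    rw [pow_add r (2 * k) 2]
    nlinarith [mul_nonneg (sq_nonneg D) (pow_nonneg hr.le (2 * k))]
  have hS1 : 1 ≤ (1 + r ^ 2 + 2 * D) ^ (k + 1) := one_le_pow₀ (by linarith)
  have hrle : r ^ (2 * k + 2) ≤ 1 := pow_le_one₀ hr.le hr1
  have hr0 : 0 < r ^ (2 * k + 2) := by positivity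
  have hSle : 1 + r ^ 2 + 2 * D ≤ (1 + r) ^ 2 := by nlinarith
  have hpow : ((1 + r) ^ 2) ^ (k + 1) = (1 + r) ^ (2 * k + 2) := by
    rw [← pow_mul]; ring_nf
  rw [div_le_iff₀ (by positivity)]
  rcases le_or_gt 0 t with ht | ht
  · have ht0 : 0 ≤ t ^ (2 * k + 1) := by positivity
    rcases le_or_gt (r ^ (2 * k + 1)) (2 * Q * t ^ (2 * k + 1)) with hc | hc
    · have htpos : 0 < t := by
        rcases ht.lt_or_eq with h | h
        · exact h
        · rw [← h, zero_pow (by omega), mul_zero] at hc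
          exact absurd hc (not_le.2 (by positivity))
      have hR := one_add_pow_succ_mul_pow_le (2 * k + 1) hr.le htpos
      have hB := sub_le_pow_succ_sub_pow_succ k (by linarith : 1 ≤ 1 + r ^ 2 + 2 * D) hSle
      rw [hpow] at hB
      have h1 : t ^ (2 * k + 1) * (2 * (r - D)) ≤ t ^ (2 * k + 1) *
          ((1 + r) ^ (2 * k + 2) - (1 + r ^ 2 + 2 * D) ^ (k + 1)) := by
        apply mul_le_mul_of_nonneg_left _ ht0
        linarith
      have h2 : (r ^ 2 - D ^ 2) * r ^ (2 * k) ≤ 2 * (r - D) * r ^ (2 * k + 1) := by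
        rw [pow_succ r (2 * k)]
        nlinarith [mul_nonneg (mul_nonneg (sub_nonneg.2 hD2) (sub_nonneg.2 hD2))
          (pow_nonneg hr.le (2 * k))]
      have h3 : 2 * (r - D) * r ^ (2 * k + 1) ≤ 2 * (r - D) * (2 * Q * t ^ (2 * k + 1)) :=
        mul_le_mul_of_nonneg_left hc (by linarith)
      have h5 : t ^ (2 * k + 1) * (2 * (r - D)) ≤
          (1 + t) ^ (2 * k + 1) * t ^ (2 * k + 1) + (1 + t) ^ (2 * k + 1) * r ^ (2 * k + 2)
            - t ^ (2 * k + 1) * (1 + r ^ 2 + 2 * D) ^ (k + 1) := by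
        linarith
      nlinarith [mul_le_mul_of_nonneg_right h5 (by linarith : 0 ≤ 2 * Q)]
    · have h1 : (1 : ℝ) ≤ (1 + t) ^ (2 * k + 1) := one_le_pow₀ (by linarith)
      have h2 := one_add_pow_le_chord (2 * k + 2) hr.le hr1
      rw [← hQ2, ← hpow] at h2
      have h3 : (1 + r ^ 2 + 2 * D) ^ (k + 1) ≤ 1 + Q * r :=
        (pow_le_pow_left₀ (by linarith) hSle _).trans h2
      have h5 : 2 * Q * t ^ (2 * k + 1) * r ≤ r ^ (2 * k + 2) := by
        rw [pow_succ r (2 * k + 1)]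
        exact mul_le_mul_of_nonneg_right hc.le hr.le
      have h6 := mul_le_mul_of_nonneg_left h3 ht0
      have h7 := mul_le_mul_of_nonneg_right h1 ht0
      have h8 := mul_le_mul_of_nonneg_right h1 hr0.le
      have h9 : r ^ (2 * k + 2) ≤ 2 *
          ((1 + t) ^ (2 * k + 1) * t ^ (2 * k + 1) + (1 + t) ^ (2 * k + 1) * r ^ (2 * k + 2)
            - t ^ (2 * k + 1) * (1 + r ^ 2 + 2 * D) ^ (k + 1)) := by
        linarith
      nlinarith
  · obtain ⟨u, rfl⟩ : ∃ u, t = -u := ⟨-t, by ring⟩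
    have hu : 0 < u := by linarith
    have hodd : Odd (2 * k + 1) := ⟨k, rfl⟩
    have hu0 : 0 < u ^ (2 * k + 1) := by positivity
    have h0 : u ^ (2 * k + 1) ≤ u ^ (2 * k + 1) * (1 + r ^ 2 + 2 * D) ^ (k + 1) :=
      le_mul_of_one_le_right hu0.le hS1
    rw [hodd.neg_pow]
    suffices H : r ^ (2 * k + 2) ≤ Q *
        ((1 + -u) ^ (2 * k + 1) * -u ^ (2 * k + 1) + (1 + -u) ^ (2 * k + 1) * r ^ (2 * k + 2)
          - -u ^ (2 * k + 1) * (1 + r ^ 2 + 2 * D) ^ (k + 1)) by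
      linarith
    rcases le_or_gt 1 u with h1u | h1u
    · have hv : (1 + -u) ^ (2 * k + 1) = - (u - 1) ^ (2 * k + 1) := by
        rw [← hodd.neg_pow]; ring
      have hv0 : 0 ≤ (u - 1) ^ (2 * k + 1) := pow_nonneg (by linarith) _
      have hu1 : 1 ≤ u ^ (2 * k + 1) := one_le_pow₀ h1u
      rw [hv]
      nlinarith [mul_nonneg hv0 (by linarith : 0 ≤ u ^ (2 * k + 1) - r ^ (2 * k + 2))]
    · have hw : 0 < 1 + -u := by linarith
      have hw1 : (1 + -u) ^ (2 * k + 1) ≤ 1 + -u :=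
        pow_le_of_le_one hw.le (by linarith) (by omega)
      have h2 : u ^ (2 * k + 2) + (1 + -u) ^ (2 * k + 1) * r ^ (2 * k + 2) ≤
          (1 + -u) ^ (2 * k + 1) * -u ^ (2 * k + 1) + (1 + -u) ^ (2 * k + 1) * r ^ (2 * k + 2)
          - -u ^ (2 * k + 1) * (1 + r ^ 2 + 2 * D) ^ (k + 1) := by
        rw [pow_succ u (2 * k + 1)]
        nlinarith [mul_le_mul_of_nonneg_right hw1 hu0.le]
      refine le_trans ?_ (mul_le_mul_of_nonneg_left h2 (by linarith))
      rcases le_or_gt u (1 / 2) with h | h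
      · have h3 : (1 / 2 : ℝ) ^ (2 * k + 1) ≤ (1 + -u) ^ (2 * k + 1) :=
          pow_le_pow_left₀ (by norm_num) (by linarith) _
        have h5 : 1 ≤ Q * (1 + -u) ^ (2 * k + 1) := by
          calc (1 : ℝ) ≤ 2 := by norm_num
            _ = Q * (1 / 2 : ℝ) ^ (2 * k + 1) := by
              rw [hQ2, pow_succ 2 (2 * k + 1), one_div, inv_pow]; field_simp
            _ ≤ _ := by gcongr
        have h6 := mul_le_mul_of_nonneg_right h5 hr0.le
        have h7 : 0 ≤ Q * u ^ (2 * k + 2) := by positivity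
        linarith
      · have h3 : (1 / 2 : ℝ) ^ (2 * k + 2) ≤ u ^ (2 * k + 2) :=
          pow_le_pow_left₀ (by norm_num) h.le _
        have h5 : 1 ≤ Q * u ^ (2 * k + 2) := by
          calc (1 : ℝ) = Q * (1 / 2 : ℝ) ^ (2 * k + 2) := by
                rw [hQ2, one_div, inv_pow]; field_simp
            _ ≤ _ := by gcongr
        have h7 : 0 ≤ Q * ((1 + -u) ^ (2 * k + 1) * r ^ (2 * k + 2)) := by positivity
        linarith

/-- Homogeneous form of `normalized_numerator_ge`: `p` and `q` stand for the coordinates of two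
vectors with square norms `A`, `B` and inner product `D`. -/
lemma numerator_ge (k : ℕ) {A B D p q : ℝ} (hA : 0 < A) (hB : 0 < B) (hAB : A ≤ B)
    (hD : D ^ 2 ≤ A * B) (hS : B ≤ A + B + 2 * D) :
    q ^ (2 * (2 * k + 1)) * ((A * B - D ^ 2) * (A * B * (A + B + 2 * D)) ^ k) ≤
      2 * 16 ^ (k + 1) / 4 * B ^ (2 * k + 1) *
      ((p + q) ^ (2 * k + 1) * p ^ (2 * k + 1) * B ^ (k + 1)
        + (p + q) ^ (2 * k + 1) * q ^ (2 * k + 1) * A ^ (k + 1)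
        - p ^ (2 * k + 1) * q ^ (2 * k + 1) * (A + B + 2 * D) ^ (k + 1)) := by
  rcases eq_or_ne q 0 with rfl | hq
  · rw [zero_pow (by omega), zero_pow (by omega)]
    simp only [zero_mul, add_zero, mul_zero, sub_zero]
    rw [← mul_pow]
    have : 0 ≤ (p * p) ^ (2 * k + 1) := pow_nonneg (mul_self_nonneg p) _
    positivity
  have hr2 : (√(A / B)) ^ 2 = A / B := Real.sq_sqrt (by positivity)
  have hr : 0 < √(A / B) := by positivity
  set r := √(A / B) with hrdef
  have hAr : A = B * r ^ 2 := by rw [hr2]; field_simp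
  obtain ⟨e, rfl⟩ : ∃ e, D = B * e := ⟨D / B, by field_simp⟩
  obtain ⟨t, rfl⟩ : ∃ t, p = q * t := ⟨p / q, by field_simp⟩
  clear_value r
  subst hAr
  have hr1 : r ≤ 1 := by
    have : B * r ^ 2 ≤ B * 1 := by linarith
    exact (sq_le_one_iff₀ hr.le).1 (le_of_mul_le_mul_left this hB)
  have he : |e| ≤ r := by
    apply abs_le_of_sq_le_sq _ hr.le
    have : B ^ 2 * e ^ 2 ≤ B ^ 2 * r ^ 2 := by linarith
    exact le_of_mul_le_mul_left this (by positivity)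
  have hS' : 0 ≤ r ^ 2 + 2 * e := by
    have : 0 ≤ B * (r ^ 2 + 2 * e) := by linarith
    exact nonneg_of_mul_nonneg_right this hB
  have key := normalized_numerator_ge k (t := t) hr hr1 he hS'
  have hs4 : 1 + r ^ 2 + 2 * e ≤ 4 := by nlinarith [(abs_le.1 he).2]
  have hs : 0 ≤ 1 + r ^ 2 + 2 * e := by linarith
  have hdet : 0 ≤ r ^ 2 - e ^ 2 := sub_nonneg.2 (sq_le_sq.2 (by rwa [abs_of_pos hr]))
  have hsk : (1 + r ^ 2 + 2 * e) ^ k ≤ 4 ^ k := pow_le_pow_left₀ hs hs4 k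
  set G := (1 + t) ^ (2 * k + 1) * t ^ (2 * k + 1) + (1 + t) ^ (2 * k + 1) * r ^ (2 * k + 2)
        - t ^ (2 * k + 1) * (1 + r ^ 2 + 2 * e) ^ (k + 1) with hG
  have hfin : (r ^ 2 - e ^ 2) * r ^ (2 * k) * (1 + r ^ 2 + 2 * e) ^ k ≤
      2 * 16 ^ (k + 1) / 4 * G := by
    rw [div_le_iff₀ (by positivity)] at key
    calc _ ≤ (r ^ 2 - e ^ 2) * r ^ (2 * k) * 4 ^ k := by gcongr
      _ ≤ G * (2 * 4 ^ (k + 1)) * 4 ^ k := by gcongr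
      _ = _ := by
        rw [show (16 : ℝ) = 4 * 4 by norm_num, mul_pow]; ring
  have hR : (q * t + q) ^ (2 * k + 1) * (q * t) ^ (2 * k + 1) * B ^ (k + 1)
        + (q * t + q) ^ (2 * k + 1) * q ^ (2 * k + 1) * (B * r ^ 2) ^ (k + 1)
        - (q * t) ^ (2 * k + 1) * q ^ (2 * k + 1) * (B * r ^ 2 + B + 2 * (B * e)) ^ (k + 1)
      = q ^ (2 * (2 * k + 1)) * B ^ (k + 1) * G := by
    rw [show q * t + q = q * (1 + t) by ring,
      show B * r ^ 2 + B + 2 * (B * e) = B * (1 + r ^ 2 + 2 * e) by ring, hG,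
      show 2 * (2 * k + 1) = (2 * k + 1) + (2 * k + 1) by ring, pow_add q,
      show 2 * k + 2 = 2 * (k + 1) by ring, pow_mul r]
    simp only [mul_pow]
    ring
  have hL : q ^ (2 * (2 * k + 1)) * ((B * r ^ 2 * B - (B * e) ^ 2) *
      (B * r ^ 2 * B * (B * r ^ 2 + B + 2 * (B * e))) ^ k) =
      q ^ (2 * (2 * k + 1)) * B ^ (3 * k + 2) *
        ((r ^ 2 - e ^ 2) * r ^ (2 * k) * (1 + r ^ 2 + 2 * e) ^ k) := by
    rw [show B * r ^ 2 * B * (B * r ^ 2 + B + 2 * (B * e)) =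
      B ^ 3 * r ^ 2 * (1 + r ^ 2 + 2 * e) by ring]
    simp only [mul_pow, ← pow_mul]
    ring
  rw [hR, hL]
  have hq2 : 0 ≤ q ^ (2 * (2 * k + 1)) := by rw [pow_mul]; positivity
  calc _ ≤ q ^ (2 * (2 * k + 1)) * B ^ (3 * k + 2) * (2 * 16 ^ (k + 1) / 4 * G) := by gcongr
    _ = _ := by ring

/-- Lower bound for the radius of a sphere centred at `o` through the vertices `y - a`, `y`,
`y + b` of a triangle, with `w = o - y`. -/
lemma four_mul_sq_mul_gram_ge {E : Type*} [NormedAddCommGroup E] [InnerProductSpace ℝ E]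
    {a b w : E} (ha : a ≠ 0) (hb : b ≠ 0) (hab : a + b ≠ 0)
    (hwa : ‖w + a‖ = ‖w‖) (hwb : ‖w - b‖ = ‖w‖) :
    ‖a‖ ^ 2 * ‖b‖ ^ 2 * ‖a + b‖ ^ 2 ≤
      4 * ‖w‖ ^ 2 * (‖a‖ ^ 2 * ‖b‖ ^ 2 - (inner ℝ a b) ^ 2) := by
  have hA : 0 < ‖a‖ ^ 2 := by positivity
  have hB : 0 < ‖b‖ ^ 2 := by positivity
  have hS : 0 < ‖a + b‖ ^ 2 := by positivity
  have h1 : ‖w + a‖ ^ 2 = _ := norm_add_sq_real w a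
  have h2 : ‖w - b‖ ^ 2 = _ := norm_sub_sq_real w b
  have h3 : ‖a + b‖ ^ 2 = _ := norm_add_sq_real a b
  rw [hwa] at h1
  rw [hwb] at h2
  have hpa : inner ℝ w a = -(‖a‖ ^ 2) / 2 := by linarith
  have hpb : inner ℝ w b = ‖b‖ ^ 2 / 2 := by linarith
  have gram : ∀ l m n : ℝ, ‖l • w + m • a + n • b‖ ^ 2 =
      l ^ 2 * ‖w‖ ^ 2 + m ^ 2 * ‖a‖ ^ 2 + n ^ 2 * ‖b‖ ^ 2
      + 2 * l * m * inner ℝ w a + 2 * l * n * inner ℝ w b + 2 * m * n * inner ℝ a b := by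
    intro l m n
    rw [norm_add_sq_real, norm_add_sq_real]
    simp only [norm_smul, mul_pow, Real.norm_eq_abs, sq_abs, inner_add_left, inner_smul_left,
      inner_smul_right, RCLike.conj_to_real]
    ring
  rw [h3] at hS ⊢
  have hinner : ∀ m n : ℝ, m • a + n • b = 0 → m * inner ℝ w a + n * inner ℝ w b = 0 := by
    intro m n h
    rw [← inner_smul_right, ← inner_smul_right, ← inner_add_right, h, inner_zero_right]
  set A := ‖a‖ ^ 2
  set B := ‖b‖ ^ 2
  set D : ℝ := inner ℝ a b
  have hdet : 0 < A * B - D ^ 2 := by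
    have hg := gram 0 B (-D)
    have hg' : ‖B • a + -D • b‖ ^ 2 = B * (A * B - D ^ 2) := by
      rw [zero_smul, zero_add] at hg
      rw [hg]; ring
    have hnn : 0 ≤ A * B - D ^ 2 :=
      nonneg_of_mul_nonneg_right (hg' ▸ sq_nonneg _) hB
    refine hnn.lt_of_ne fun h0 => ?_
    rw [← h0, mul_zero, sq_eq_zero_iff, norm_eq_zero] at hg'
    have h5 := hinner _ _ hg'
    rw [hpa, hpb] at h5
    have h6 : D = -A := by
      have : B * (A + D) = 0 := by linarith
      rcases mul_eq_zero.1 this with h | h <;> linarith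
    rw [h6] at h0 hS
    have h7 : A * (B - A) = 0 := by linarith
    rcases mul_eq_zero.1 h7 with h | h <;> linarith
  have hg := gram (A * B - D ^ 2) ((A * B + B * D) / 2) (-(A * B + A * D) / 2)
  rw [hpa, hpb] at hg
  have h8 : 0 ≤ (A * B - D ^ 2) *
      (4 * ‖w‖ ^ 2 * (A * B - D ^ 2) - A * B * (A + 2 * D + B)) := by
    have := sq_nonneg ‖(A * B - D ^ 2) • w + ((A * B + B * D) / 2) • a +
      (-(A * B + A * D) / 2) • b‖
    rw [hg] at this
    linarith
  linarith [nonneg_of_mul_nonneg_right h8 hdet]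

lemma Kker_one (d k : ℕ) (i : Fin d) (x : EuclideanSpace ℝ (Fin d)) :
    Kker d (k + 1) 1 i x = (x i) ^ (2 * k + 1) / (‖x‖ ^ 2) ^ (k + 1) := by
  unfold Kker
  rw [show 2 * (k + 1) - 1 = 2 * k + 1 by omega,
    show 2 * ((k + 1 : ℕ) : ℝ) - 1 + 1 = ((2 * (k + 1) : ℕ) : ℝ) by push_cast; ring,
    Real.rpow_natCast, pow_mul]

lemma permI_one_eq (d k : ℕ) (i : Fin d) {x y z : EuclideanSpace ℝ (Fin d)}
    (hxy : y - x ≠ 0) (hyz : z - y ≠ 0) (hxz : (y - x) + (z - y) ≠ 0) :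
    permI d (k + 1) 1 i x y z =
      (((y - x) i + (z - y) i) ^ (2 * k + 1) * (y - x) i ^ (2 * k + 1)
          * (‖z - y‖ ^ 2) ^ (k + 1)
        + ((y - x) i + (z - y) i) ^ (2 * k + 1) * (z - y) i ^ (2 * k + 1)
          * (‖y - x‖ ^ 2) ^ (k + 1)
        - (y - x) i ^ (2 * k + 1) * (z - y) i ^ (2 * k + 1)
          * (‖(y - x) + (z - y)‖ ^ 2) ^ (k + 1)) /
      (‖y - x‖ ^ 2 * ‖z - y‖ ^ 2 * ‖(y - x) + (z - y)‖ ^ 2) ^ (k + 1) := by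
  have hodd : Odd (2 * k + 1) := ⟨k, rfl⟩
  have hneg : ∀ v : EuclideanSpace ℝ (Fin d),
      Kker d (k + 1) 1 i (-v) = - Kker d (k + 1) 1 i v := by
    intro v
    rw [Kker_one, Kker_one, norm_neg, PiLp.neg_apply, hodd.neg_pow, neg_div]
  have hsum : z - x = (y - x) + (z - y) := by abel
  unfold permI
  rw [← neg_sub y x, ← neg_sub z x, ← neg_sub z y, hneg, hneg, hneg, hsum, Kker_one, Kker_one,
    Kker_one, PiLp.add_apply]
  have h1 : ‖y - x‖ ≠ 0 := norm_ne_zero_iff.2 hxy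
  have h2 : ‖z - y‖ ≠ 0 := norm_ne_zero_iff.2 hyz
  have h3 : ‖(y - x) + (z - y)‖ ≠ 0 := norm_ne_zero_iff.2 hxz
  generalize ‖y - x‖ = A at *
  generalize ‖z - y‖ = B at *
  generalize ‖(y - x) + (z - y)‖ = S at *
  simp only [mul_pow]
  field_simp
  ring

lemma menger_sq_mul_le (d : ℕ) {x y z : EuclideanSpace ℝ (Fin d)}
    (h : AffineIndependent ℝ ![x, y, z])
    (hxy : y - x ≠ 0) (hyz : z - y ≠ 0) (hxz : (y - x) + (z - y) ≠ 0) :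
    (menger d x y z h) ^ 2 * (‖y - x‖ ^ 2 * ‖z - y‖ ^ 2 * ‖(y - x) + (z - y)‖ ^ 2) ≤
      4 * (‖y - x‖ ^ 2 * ‖z - y‖ ^ 2 - (inner ℝ (y - x) (z - y)) ^ 2) := by
  set T : Affine.Simplex ℝ (EuclideanSpace ℝ (Fin d)) 2 := ⟨![x, y, z], h⟩ with hT
  have hR : 0 < T.circumradius := T.circumradius_pos
  have hx : ‖x - T.circumcenter‖ = T.circumradius := by
    simpa [hT, dist_eq_norm] using T.dist_circumcenter_eq_circumradius 0
  have hy : ‖y - T.circumcenter‖ = T.circumradius := by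
    simpa [hT, dist_eq_norm] using T.dist_circumcenter_eq_circumradius 1
  have hz : ‖z - T.circumcenter‖ = T.circumradius := by
    simpa [hT, dist_eq_norm] using T.dist_circumcenter_eq_circumradius 2
  rw [norm_sub_rev] at hx hy hz
  have key := four_mul_sq_mul_gram_ge (w := T.circumcenter - y) hxy hyz hxz
    (by rw [sub_add_sub_cancel, hx, hy])
    (by rw [sub_sub, add_sub_cancel, hz, hy])
  rw [hy] at key
  have hm : menger d x y z h = 1 / T.circumradius := rfl
  rw [hm, div_pow, one_pow, one_div, inv_mul_le_iff₀ (by positivity)]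
  linarith

/-- There is `C = C(n) > 0` such that for any three affinely independent (i.e. pairwise
distinct and non-collinear) points `x, y, z ∈ ℝ^d` with, writing `a = y - x`, `b = z - y`,
`|a| ≤ |b| ≤ |a+b|`, and every coordinate `i`:
`p^i_{1,n}(x,y,z) ≥ C (b_i/|b|)^{2(2n-1)} c(x,y,z)²`. -/
theorem stmt4 (d n : ℕ) (hd : 1 ≤ d) (hn : 1 ≤ n) :
    ∃ C : ℝ, 0 < C ∧
      ∀ (x y z : EuclideanSpace ℝ (Fin d)) (h : AffineIndependent ℝ ![x, y, z]),
        ‖y - x‖ ≤ ‖z - y‖ → ‖z - y‖ ≤ ‖(y - x) + (z - y)‖ →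
        ∀ i : Fin d,
          C * ((z - y) i / ‖z - y‖) ^ (2 * (2 * n - 1)) * (menger d x y z h) ^ 2 ≤
            permI d n 1 i x y z := by
  obtain ⟨k, rfl⟩ : ∃ k, n = k + 1 := ⟨n - 1, by omega⟩
  refine ⟨1 / (2 * 16 ^ (k + 1)), by positivity, ?_⟩
  intro x y z h hab hbs i
  have hxy : y - x ≠ 0 := sub_ne_zero.2 fun e => by
    simpa using h.injective.ne (show (1 : Fin 3) ≠ 0 by decide) (by simpa using e)
  have hyz : z - y ≠ 0 := fun e => hxy (by simpa [e] using hab)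
  have hxz : (y - x) + (z - y) ≠ 0 := fun e => hyz (by simpa [e] using hbs)
  have hm := menger_sq_mul_le d h hxy hyz hxz
  have hcs : (inner ℝ (y - x) (z - y)) ^ 2 ≤ ‖y - x‖ ^ 2 * ‖z - y‖ ^ 2 := by
    rw [← mul_pow]
    exact sq_le_sq.2 ((abs_real_inner_le_norm _ _).trans (le_abs_self _))
  have hA : 0 < ‖y - x‖ ^ 2 := by positivity
  have hB : 0 < ‖z - y‖ ^ 2 := by positivity
  have hS : 0 < ‖(y - x) + (z - y)‖ ^ 2 := by positivity
  have hAB : ‖y - x‖ ^ 2 ≤ ‖z - y‖ ^ 2 := by gcongr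
  have hBS : ‖z - y‖ ^ 2 ≤ ‖(y - x) + (z - y)‖ ^ 2 := by gcongr
  have hadd : ‖(y - x) + (z - y)‖ ^ 2 =
      ‖y - x‖ ^ 2 + ‖z - y‖ ^ 2 + 2 * inner ℝ (y - x) (z - y) := by
    rw [norm_add_sq_real]; ring
  have key := numerator_ge k (p := (y - x) i) (q := (z - y) i) hA hB hAB hcs (hadd ▸ hBS)
  rw [← hadd] at key
  rw [permI_one_eq d k i hxy hyz hxz, show 2 * (k + 1) - 1 = 2 * k + 1 by omega, div_pow,
    pow_mul ‖z - y‖]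
  have hq2 : 0 ≤ (z - y) i ^ (2 * (2 * k + 1)) := by rw [pow_mul]; positivity
  generalize ‖y - x‖ ^ 2 = A at *
  generalize ‖z - y‖ ^ 2 = B at *
  generalize ‖(y - x) + (z - y)‖ ^ 2 = S at *
  set F := ((y - x) i + (z - y) i) ^ (2 * k + 1) * (y - x) i ^ (2 * k + 1) * B ^ (k + 1)
        + ((y - x) i + (z - y) i) ^ (2 * k + 1) * (z - y) i ^ (2 * k + 1) * A ^ (k + 1)
        - (y - x) i ^ (2 * k + 1) * (z - y) i ^ (2 * k + 1) * S ^ (k + 1)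
  rw [le_div_iff₀ (by positivity)]
  have hP : 0 < A * B * S := by positivity
  calc _ = 1 / (2 * 16 ^ (k + 1)) * ((z - y) i ^ (2 * (2 * k + 1)) / B ^ (2 * k + 1)) *
        (menger d x y z h ^ 2 * (A * B * S)) * (A * B * S) ^ k := by ring
    _ ≤ 1 / (2 * 16 ^ (k + 1)) * ((z - y) i ^ (2 * (2 * k + 1)) / B ^ (2 * k + 1)) *
        (4 * (A * B - (inner ℝ (y - x) (z - y)) ^ 2)) * (A * B * S) ^ k := by gcongr
    _ = 4 / (2 * 16 ^ (k + 1)) / B ^ (2 * k + 1) * ((z - y) i ^ (2 * (2 * k + 1)) *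
        ((A * B - (inner ℝ (y - x) (z - y)) ^ 2) * (A * B * S) ^ k)) := by ring
    _ ≤ 4 / (2 * 16 ^ (k + 1)) / B ^ (2 * k + 1) *
        (2 * 16 ^ (k + 1) / 4 * B ^ (2 * k + 1) * F) := by gcongr
    _ = F := by field_simp
end

section
/- For every integer n ≥ 1, every integer l with 0 ≤ l ≤ n−1, and every real number α, the following identity holds: Σ_{k=1}^{l+1} (−1)^k · (Π_{j=1}^{k} (2j−1−α)) / (2^{n−k} · (2k−1)! · (l+1−k)!) = −(1−α) · (Π_{j=0}^{l−1} (α+2j)) / (2^{n−1−l} · (2l+1)!), where an empty product equals 1. -/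
open scoped BigOperators

/-- The Chu–Vandermonde identity for rising products with step `d`. -/
theorem sum_choose_mul_prod_div_prod {d : ℝ} (hd : 0 ≤ d) (l : ℕ) (b c : ℝ) (hc : 0 < c) :
    ∑ i ∈ Finset.range (l + 1), (l.choose i : ℝ) * ((-1) ^ i *
        (∏ j ∈ Finset.range i, (b + d * j)) / ∏ j ∈ Finset.range i, (c + d * j)) =
      (∏ j ∈ Finset.range l, (c - b + d * j)) / ∏ j ∈ Finset.range l, (c + d * j) := by
  induction l generalizing b c with
  | zero => simp
  | succ l ih =>
    have hcd : 0 < c + d := by positivity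
    have shift (x : ℝ) (i : ℕ) : ∏ j ∈ Finset.range (i + 1), (x + d * (j : ℝ)) =
        x * ∏ j ∈ Finset.range i, (x + d + d * (j : ℝ)) := by
      rw [Finset.prod_range_succ', mul_comm]
      congr 1
      · simp
      · refine Finset.prod_congr rfl fun j _ => ?_
        push_cast
        ring
    have hsum : ∑ i ∈ Finset.range (l + 1), (l.choose i : ℝ) * ((-1) ^ (i + 1) *
        (∏ j ∈ Finset.range (i + 1), (b + d * j)) / ∏ j ∈ Finset.range (i + 1), (c + d * j)) =
        -(b / c) * ((∏ j ∈ Finset.range l, (c - b + d * j)) /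
          ∏ j ∈ Finset.range l, (c + d + d * j)) := by
      have h := ih (b + d) (c + d) hcd
      rw [add_sub_add_right_eq_sub] at h
      rw [← h, Finset.mul_sum]
      refine Finset.sum_congr rfl fun i _ => ?_
      rw [shift, shift, pow_succ, mul_div_assoc, mul_div_mul_comm]
      ring
    have hne (x : ℝ) (hx : 0 < x) (i : ℕ) : ∏ j ∈ Finset.range i, (x + d * (j : ℝ)) ≠ 0 :=
      Finset.prod_ne_zero_iff.mpr fun j _ => by positivity
    have hlast := (shift c l).symm.trans (Finset.prod_range_succ _ l)
    have h1 := hne c hc l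
    have h2 := hne (c + d) hcd l
    have h3 : c + d * (l : ℝ) ≠ 0 := by positivity
    rw [Finset.sum_choose_succ_mul (fun i _ => (-1 : ℝ) ^ i *
        (∏ j ∈ Finset.range i, (b + d * j)) / ∏ j ∈ Finset.range i, (c + d * j)), ih b c hc, hsum,
      Finset.prod_range_succ, Finset.prod_range_succ]
    have h4 : -(b / c) * ((∏ j ∈ Finset.range l, (c - b + d * j)) /
        ∏ j ∈ Finset.range l, (c + d + d * j)) =
        -b * (∏ j ∈ Finset.range l, (c - b + d * j)) /
          ((∏ j ∈ Finset.range l, (c + d * j)) * (c + d * l)) := by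
      rw [← hlast]
      field_simp
    rw [h4]
    field_simp
    ring

theorem factorial_two_mul_add_one_eq_prod (i : ℕ) :
    ((2 * i + 1).factorial : ℝ) =
      2 ^ i * (i.factorial : ℝ) * ∏ j ∈ Finset.range i, (3 + 2 * (j : ℝ)) := by
  induction i with
  | zero => simp
  | succ i ih =>
    rw [show 2 * (i + 1) + 1 = (2 * i + 1) + 1 + 1 by ring, Nat.factorial_succ,
      Nat.factorial_succ, Nat.factorial_succ i, Finset.prod_range_succ]
    push_cast
    rw [ih]
    ring

/-- Lemma (coefficient identity): for `n ≥ 1`, `0 ≤ l ≤ n-1` and any real `α`,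
`Σ_{k=1}^{l+1} (-1)^k (1-α)(3-α)⋯(2k-1-α) / (2^{n-k} (2k-1)! (l+1-k)!)
  = -(1-α) α(α+2)⋯(α+2(l-1)) / (2^{n-1-l} (2l+1)!)`. -/
theorem stmt5 (n l : ℕ) (hn : 1 ≤ n) (hl : l < n) (α : ℝ) :
    ∑ k ∈ Finset.Icc 1 (l + 1),
        (-1 : ℝ) ^ k * (∏ j ∈ Finset.Icc 1 k, (2 * (j : ℝ) - 1 - α)) /
          (2 ^ (n - k) * ((2 * k - 1).factorial : ℝ) * ((l + 1 - k).factorial : ℝ)) =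
      -(1 - α) * (∏ j ∈ Finset.range l, (α + 2 * (j : ℝ))) /
        (2 ^ (n - 1 - l) * ((2 * l + 1).factorial : ℝ)) := by
  obtain ⟨m, rfl⟩ : ∃ m, n = l + m + 1 := ⟨n - l - 1, by omega⟩
  have hP (i : ℕ) : ∏ j ∈ Finset.range i, (3 + 2 * (j : ℝ)) ≠ 0 :=
    Finset.prod_ne_zero_iff.mpr fun j _ => by positivity
  have hprod (i : ℕ) : ∏ j ∈ Finset.Icc 1 (i + 1), (2 * (j : ℝ) - 1 - α) =
      (1 - α) * ∏ j ∈ Finset.range i, (3 - α + 2 * (j : ℝ)) := by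
    induction i with
    | zero => norm_num
    | succ i ih =>
      rw [Finset.prod_Icc_succ_top (by omega), ih, Finset.prod_range_succ]
      push_cast
      ring
  have hCV := sum_choose_mul_prod_div_prod (d := 2) (by norm_num) l (3 - α) 3 (by norm_num)
  rw [sub_sub_cancel] at hCV
  have hfac := Nat.cast_ne_zero (R := ℝ).mpr l.factorial_ne_zero
  have hrhs : -(1 - α) * (∏ j ∈ Finset.range l, (α + 2 * (j : ℝ))) /
        (2 ^ (l + m + 1 - 1 - l) * ((2 * l + 1).factorial : ℝ)) =
      -(1 - α) / (2 ^ (l + m) * (l.factorial : ℝ)) *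
        ((∏ j ∈ Finset.range l, (α + 2 * (j : ℝ))) /
          ∏ j ∈ Finset.range l, (3 + 2 * (j : ℝ))) := by
    rw [factorial_two_mul_add_one_eq_prod, show l + m + 1 - 1 - l = m by omega, pow_add]
    have := hP l
    field_simp
  rw [hrhs, ← hCV, Finset.mul_sum, ← Finset.Ico_add_one_right_eq_Icc,
    Finset.sum_Ico_eq_sum_range]
  refine Finset.sum_congr rfl fun i hi => ?_
  obtain ⟨r, rfl⟩ : ∃ r, l = i + r :=
    ⟨l - i, by have := Finset.mem_range.mp hi; omega⟩
  rw [add_comm 1 i, hprod, show 2 * (i + 1) - 1 = 2 * i + 1 by omega,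
    show i + r + 1 - (i + 1) = r by omega, show i + r + m + 1 - (i + 1) = r + m by omega,
    factorial_two_mul_add_one_eq_prod, Nat.cast_add_choose, pow_succ, add_assoc i r m,
    pow_add 2 i]
  have := hP i
  have hi' := Nat.cast_ne_zero (R := ℝ).mpr i.factorial_ne_zero
  have hr' := Nat.cast_ne_zero (R := ℝ).mpr r.factorial_ne_zero
  field_simp
end

section
/- Let n ≥ 1 be an integer, 0 < α < 1, and i ∈ {1, 2}. There exist a nonzero constant c ∈ ℂ and a homogeneous polynomial p(ξ₁, ξ₂) of degree 2n−2 with real coefficients that does not vanish on ℝ²∖{0}, such that for every Schwartz function φ on ℝ²: ∫_{ℝ²} K^i_{α,n}(x) · (𝓕φ)(x) dx = c · ∫_{ℝ²} (ξ_i · p(ξ₁, ξ₂)/|ξ|^{2n+1−α}) · φ(ξ) dξ, where 𝓕 denotes the Fourier transform. In other words, the Fourier transform of K^i_{α,n} in the sense of tempered distributions equals c · ξ_i · p(ξ₁,ξ₂)/|ξ|^{2n+1−α}. -/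
open scoped BigOperators

open scoped FourierTransform

open MeasureTheory Set Real

section Positivity

open scoped Nat

theorem integrableOn_rpow_mul_one_sub_rpow {a b : ℝ} (ha : 0 < a) (hb : 0 < b) :
    IntegrableOn (fun t : ℝ => t ^ (b - 1) * (1 - t) ^ (a - 1)) (Ioo 0 1) := by
  have h := Complex.betaIntegral_convergent (u := b) (v := a) (by simpa) (by simpa)
  rw [intervalIntegrable_iff_integrableOn_Ioo_of_le zero_le_one] at h
  refine IntegrableOn.congr_fun (Integrable.re h) (fun t ht => ?_) measurableSet_Ioo
  have h1 : (0 : ℝ) ≤ 1 - t := by linarith [ht.2]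
  simp only [RCLike.re_eq_complex_re]
  rw [← Complex.ofReal_re (t ^ (b - 1) * (1 - t) ^ (a - 1))]
  congr 1
  rw [Complex.ofReal_mul, Complex.ofReal_cpow ht.1.le, Complex.ofReal_cpow h1]
  push_cast
  rfl

theorem setIntegral_rpow_mul_one_sub_rpow {a b : ℝ} (ha : 0 < a) (hb : 0 < b) :
    ∫ t in Ioo (0 : ℝ) 1, t ^ (b - 1) * (1 - t) ^ (a - 1) =
      Gamma b * Gamma a / Gamma (b + a) := by
  have h := ProbabilityTheory.beta_eq_betaIntegralReal b a hb ha
  rw [ProbabilityTheory.beta] at h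
  rw [h, Complex.betaIntegral, intervalIntegral.integral_of_le zero_le_one,
    integral_Ioc_eq_integral_Ioo, ← Complex.ofReal_re (∫ t in Ioo (0 : ℝ) 1, _),
    ← integral_complex_ofReal]
  congr 1
  refine setIntegral_congr_fun measurableSet_Ioo (fun t ht => ?_)
  have h1 : (0 : ℝ) ≤ 1 - t := by linarith [ht.2]
  rw [Complex.ofReal_mul, Complex.ofReal_cpow ht.1.le, Complex.ofReal_cpow h1]
  push_cast
  rfl

theorem sum_choose_Gamma_ratio_pos {a b : ℝ} (ha : 0 < a) (hb : 0 < b) (N : ℕ) {u v : ℝ}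
    (huv : u ≤ v) (hv : 0 < v) :
    0 < ∑ j ∈ Finset.range (N + 1),
      (-1 : ℝ) ^ j * N.choose j * (Gamma (b + j) / Gamma (b + j + a)) * u ^ j * v ^ (N - j) := by
  have hGa := Gamma_pos_of_pos ha
  have hint : ∀ j : ℕ, IntegrableOn (fun t : ℝ => t ^ (b + j - 1) * (1 - t) ^ (a - 1))
      (Ioo 0 1) := fun j => integrableOn_rpow_mul_one_sub_rpow ha (by positivity)
  have hcongr : ∀ t ∈ Ioo (0 : ℝ) 1, t ^ (b - 1) * (1 - t) ^ (a - 1) * (v - t * u) ^ N =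
      ∑ j ∈ Finset.range (N + 1), ((-1 : ℝ) ^ j * N.choose j * u ^ j * v ^ (N - j)) *
        (t ^ (b + j - 1) * (1 - t) ^ (a - 1)) := by
    intro t ht
    rw [show v - t * u = -(t * u) + v by ring, add_pow, Finset.mul_sum]
    refine Finset.sum_congr rfl fun j _ => ?_
    rw [show b + j - 1 = (b - 1) + j by ring, rpow_add ht.1, rpow_natCast, neg_pow, mul_pow]
    ring
  have hpos : 0 < ∫ t in Ioo (0 : ℝ) 1, t ^ (b - 1) * (1 - t) ^ (a - 1) * (v - t * u) ^ N := by
    rw [setIntegral_pos_iff_support_of_nonneg_ae]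
    · have : Ioo (0 : ℝ) 1 ⊆ (Function.support fun t : ℝ =>
          t ^ (b - 1) * (1 - t) ^ (a - 1) * (v - t * u) ^ N) ∩ Ioo 0 1 := by
        refine fun t ht => ⟨?_, ht⟩
        have h1 : 0 < 1 - t := by linarith [ht.2]
        have h2 : 0 < v - t * u := by nlinarith [ht.1, ht.2]
        have := ht.1
        exact (by positivity : 0 < t ^ (b - 1) * (1 - t) ^ (a - 1) * (v - t * u) ^ N).ne'
      exact lt_of_lt_of_le (by simp) (measure_mono this)
    · refine (ae_restrict_iff' measurableSet_Ioo).2 (Filter.Eventually.of_forall fun t ht => ?_)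
      have h1 : 0 < 1 - t := by linarith [ht.2]
      have h2 : 0 < v - t * u := by nlinarith [ht.1, ht.2]
      have := ht.1
      simp only [Pi.zero_apply]
      positivity
    · refine IntegrableOn.congr_fun (integrable_finsetSum _ fun j _ => (hint j).const_mul _)
        (fun t ht => (hcongr t ht).symm) measurableSet_Ioo
  rw [setIntegral_congr_fun measurableSet_Ioo hcongr,
    integral_finsetSum _ fun j _ => (hint j).const_mul _] at hpos
  refine pos_of_mul_pos_right (a := Gamma a) (hpos.trans_eq ?_) hGa.le
  rw [Finset.mul_sum]
  refine Finset.sum_congr rfl fun j _ => ?_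
  rw [integral_const_mul, setIntegral_rpow_mul_one_sub_rpow ha (by positivity)]
  ring

theorem coeff_hermite_odd_mul_two_pow {N j : ℕ} (hj : j ≤ N) :
    ((Polynomial.hermite (2 * N + 1)).coeff (2 * j + 1) : ℝ) * 2 ^ j =
      (-1) ^ N * ((2 * N + 1)! * √π / (2 ^ (N + 1) * N !)) *
        ((-1) ^ j * N.choose j / Gamma (j + 3 / 2)) := by
  obtain ⟨k, rfl⟩ := Nat.exists_eq_add_of_le hj
  have hG : Gamma (j + 3 / 2) = (2 * j + 1)‼ * √π / 2 ^ (j + 1) := by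
    have := Gamma_nat_add_half (j + 1)
    push_cast at this
    rw [show (j : ℝ) + 3 / 2 = j + 1 + 1 / 2 by ring, this]
    rfl
  have hπ : 0 < √π := by positivity
  have e1 : ((2 * j + 1)! : ℝ) = (2 * j + 1)‼ * (2 ^ j * j !) := by
    rw [Nat.factorial_eq_mul_doubleFactorial, Nat.doubleFactorial_two_mul]; push_cast; ring
  have e2 : ((2 * k)! : ℝ) = (2 * k - 1)‼ * (2 ^ k * k !) := by
    rcases k with _ | k
    · simp
    · rw [show 2 * (k + 1) = (2 * k + 1) + 1 by ring, Nat.factorial_eq_mul_doubleFactorial,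
        show 2 * k + 1 + 1 = 2 * (k + 1) by ring, Nat.doubleFactorial_two_mul]
      push_cast [show 2 * (k + 1) - 1 = 2 * k + 1 by omega]
      ring
  have hc : (Polynomial.hermite (2 * (j + k) + 1)).coeff (2 * j + 1) =
      (-1) ^ k * (2 * k - 1)‼ * Nat.choose (2 * (j + k) + 1) (2 * j + 1) := by
    rw [show 2 * (j + k) + 1 = 2 * k + (2 * j + 1) by ring, Polynomial.coeff_hermite_explicit]
  have c1 : ((2 * (j + k) + 1).choose (2 * j + 1) : ℝ) =
      (2 * (j + k) + 1)! / ((2 * j + 1)! * (2 * k)!) := by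
    rw [Nat.cast_choose ℝ (by omega), show 2 * (j + k) + 1 - (2 * j + 1) = 2 * k by omega]
  have c2 : ((j + k).choose j : ℝ) = (j + k)! / (j ! * k !) := by
    rw [Nat.cast_choose ℝ (by omega), show j + k - j = k by omega]
  have p1 : (0 : ℝ) < (2 * j + 1)‼ := by exact_mod_cast Nat.doubleFactorial_pos _
  have p2 : (0 : ℝ) < (2 * k - 1)‼ := by exact_mod_cast Nat.doubleFactorial_pos _
  rw [hc]
  push_cast
  rw [c1, c2, e1, e2, hG]
  have hsign : (-1 : ℝ) ^ (j + k) * (-1) ^ j = (-1) ^ k := by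
    rw [pow_add, mul_right_comm, ← mul_pow]; simp
  rw [← hsign]
  field_simp
  ring

end Positivity

section GammaIntegral

variable {V : Type*} [NormedAddCommGroup V]

theorem integral_rpow_mul_exp_neg_pi_norm_sq {s : ℝ} (hs : 0 < s) {x : V} (hx : x ≠ 0) :
    ∫ t in Ioi (0 : ℝ), t ^ (s - 1) * exp (-(π * t * ‖x‖ ^ 2)) =
      Gamma s * π ^ (-s) * ‖x‖ ^ (-(2 * s)) := by
  have h0 : 0 < ‖x‖ := norm_pos_iff.2 hx
  have h := integral_rpow_mul_exp_neg_mul_Ioi hs (r := π * ‖x‖ ^ 2) (by positivity)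
  calc _ = ∫ t in Ioi (0 : ℝ), t ^ (s - 1) * exp (-(π * ‖x‖ ^ 2 * t)) := by
        congr 1; ext t; ring_nf
    _ = _ := by
        rw [h, one_div, inv_rpow (by positivity), ← rpow_neg (by positivity),
          mul_rpow (by positivity) (by positivity), ← rpow_natCast ‖x‖ 2, ← rpow_mul h0.le]
        push_cast
        rw [mul_neg]
        ring

theorem integrableOn_rpow_mul_exp_neg_pi_norm_sq {s : ℝ} (hs : 0 < s) {x : V} (hx : x ≠ 0) :
    IntegrableOn (fun t : ℝ => t ^ (s - 1) * exp (-(π * t * ‖x‖ ^ 2))) (Ioi 0) := by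
  have h0 : 0 < ‖x‖ := norm_pos_iff.2 hx
  have := integrableOn_rpow_mul_exp_neg_mul_rpow (s := s - 1) (p := 1) (b := π * ‖x‖ ^ 2)
    (by linarith) one_pos (by positivity)
  refine this.congr_fun (fun t _ => ?_) measurableSet_Ioi
  simp only [rpow_one]
  ring_nf

variable [InnerProductSpace ℝ V] [FiniteDimensional ℝ V] [MeasurableSpace V] [BorelSpace V]
  [Nontrivial V]

theorem integral_norm_rpow_mul_eq_gaussian_superposition {s : ℝ} (hs : 0 < s) {f : V → ℂ}
    (hf : Continuous f) (hi : Integrable fun x => ((‖x‖ ^ (-(2 * s)) : ℝ) : ℂ) * f x) :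
    IntegrableOn (fun t : ℝ => ((t ^ (s - 1) : ℝ) : ℂ) *
        ∫ x, ((exp (-(π * t * ‖x‖ ^ 2)) : ℝ) : ℂ) * f x) (Ioi 0) ∧
      ∫ t in Ioi (0 : ℝ), ((t ^ (s - 1) : ℝ) : ℂ) *
        ∫ x, ((exp (-(π * t * ‖x‖ ^ 2)) : ℝ) : ℂ) * f x =
      ((Gamma s * π ^ (-s) : ℝ) : ℂ) * ∫ x, ((‖x‖ ^ (-(2 * s)) : ℝ) : ℂ) * f x := by
  have hne : ∀ᵐ x : V, x ≠ 0 := by simp [ae_iff]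
  set G : V × ℝ → ℂ := fun q =>
    ((q.2 ^ (s - 1) * exp (-(π * q.2 * ‖q.1‖ ^ 2)) : ℝ) : ℂ) * f q.1 with hG
  have hGm : AEStronglyMeasurable G (volume.prod (volume.restrict (Ioi 0))) := by
    refine AEStronglyMeasurable.mul ?_ (hf.comp continuous_fst).aestronglyMeasurable
    refine Measurable.aestronglyMeasurable ?_
    fun_prop
  have hGi : Integrable G (volume.prod (volume.restrict (Ioi 0))) := by
    rw [integrable_prod_iff hGm]
    refine ⟨?_, ?_⟩
    · filter_upwards [hne] with x hx
      exact ((integrableOn_rpow_mul_exp_neg_pi_norm_sq hs hx).ofReal (𝕜 := ℂ)).mul_const (f x)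
    · refine (hi.norm.const_mul (Gamma s * π ^ (-s))).congr ?_
      filter_upwards [hne] with x hx
      rw [norm_mul, Complex.norm_real, norm_of_nonneg (by positivity), ← mul_assoc,
        ← integral_rpow_mul_exp_neg_pi_norm_sq hs hx, ← integral_mul_const]
      refine setIntegral_congr_fun measurableSet_Ioi (fun t ht => ?_)
      have : (0 : ℝ) < t := ht
      simp only [hG]
      rw [norm_mul, Complex.norm_real, norm_of_nonneg (by positivity)]
  have hin : ∀ t : ℝ, ∫ x, G (x, t) = ((t ^ (s - 1) : ℝ) : ℂ) *
        ∫ x, ((exp (-(π * t * ‖x‖ ^ 2)) : ℝ) : ℂ) * f x := by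
    intro t
    rw [← integral_const_mul]
    congr 1; ext x
    simp only [hG]
    push_cast
    ring
  refine ⟨?_, ?_⟩
  · have := hGi.swap.integral_prod_left
    refine this.congr (Filter.Eventually.of_forall fun t => ?_)
    simpa using hin t
  · simp_rw [← hin]
    rw [← integral_integral_swap (f := fun x t => G (x, t)) hGi, ← integral_const_mul]
    refine integral_congr_ae ?_
    filter_upwards [hne] with x hx
    simp only [hG]
    rw [integral_mul_const, integral_complex_ofReal,
      integral_rpow_mul_exp_neg_pi_norm_sq hs hx]
    push_cast
    ring

end GammaIntegral

section Inversion

theorem integrableOn_and_integral_comp_inv {γ : ℝ} {F : ℝ → ℂ}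
    (hF : IntegrableOn (fun u : ℝ => ((u ^ (γ - 1) : ℝ) : ℂ) * F u) (Ioi 0)) :
    IntegrableOn (fun t : ℝ => ((t ^ (-γ - 1) : ℝ) : ℂ) * F t⁻¹) (Ioi 0) ∧
      ∫ t in Ioi (0 : ℝ), ((t ^ (-γ - 1) : ℝ) : ℂ) * F t⁻¹ =
        ∫ u in Ioi (0 : ℝ), ((u ^ (γ - 1) : ℝ) : ℂ) * F u := by
  have hcongr : ∀ t ∈ Ioi (0 : ℝ),
      (|(-1 : ℝ)| * t ^ ((-1 : ℝ) - 1)) • ((((t ^ (-1 : ℝ)) ^ (γ - 1) : ℝ) : ℂ) * F (t ^ (-1 : ℝ))) =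
        ((t ^ (-γ - 1) : ℝ) : ℂ) * F t⁻¹ := by
    intro t ht
    have ht : 0 < t := ht
    rw [Complex.real_smul, ← mul_assoc, ← Complex.ofReal_mul, rpow_neg_one, inv_rpow ht.le,
      ← rpow_neg ht.le, abs_neg, abs_one, one_mul, ← rpow_add ht]
    ring_nf
  refine ⟨?_, ?_⟩
  · exact ((integrableOn_Ioi_comp_rpow_iff _ (by norm_num : (-1 : ℝ) ≠ 0)).2 hF).congr_fun
      hcongr measurableSet_Ioi
  · rw [← integral_comp_rpow_Ioi (fun u : ℝ => ((u ^ (γ - 1) : ℝ) : ℂ) * F u)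
      (by norm_num : (-1 : ℝ) ≠ 0)]
    exact (setIntegral_congr_fun measurableSet_Ioi hcongr).symm

end Inversion

section Schwartz

open scoped SchwartzMap

theorem integrable_norm_rpow_neg_mul_schwartz {a : ℝ} (ha0 : 0 ≤ a) (ha : a < 2)
    (φ : 𝓢(EuclideanSpace ℝ (Fin 2), ℂ)) :
    Integrable fun x => ‖x‖ ^ (-a) * ‖φ x‖ := by
  obtain ⟨C, hC, hφ⟩ := φ.decay 0 0
  simp only [pow_zero, one_mul, norm_iteratedFDeriv_zero] at hφ
  have hball : Integrable fun x : EuclideanSpace ℝ (Fin 2) =>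
      (Ioo (0 : ℝ) 1).indicator (fun r => r ^ (-a)) ‖x‖ := by
    rw [integrable_fun_norm_addHaar volume (f := (Ioo (0 : ℝ) 1).indicator fun r => r ^ (-a))]
    have h1 : IntegrableOn (fun r : ℝ => r ^ (1 - a)) (Ioo 0 1) := by
      rw [intervalIntegral.integrableOn_Ioo_rpow_iff one_pos]
      linarith
    have h2 := (h1.integrable_indicator measurableSet_Ioo).integrableOn (s := Ioi 0)
    refine h2.congr_fun (fun r hr => ?_) measurableSet_Ioi
    have hr : 0 < r := hr
    by_cases h : r ∈ Ioo (0 : ℝ) 1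
    · simp only [indicator_of_mem h, finrank_euclideanSpace, Fintype.card_fin, smul_eq_mul]
      rw [sub_eq_add_neg, rpow_add hr]
      simp
    · simp [indicator_of_notMem h]
  have hne : ∀ᵐ x : EuclideanSpace ℝ (Fin 2), x ≠ 0 := by simp [ae_iff]
  refine ((hball.const_mul C).add φ.integrable.norm).mono' ?_ ?_
  · refine AEStronglyMeasurable.mul (Measurable.aestronglyMeasurable (by fun_prop)) ?_
    exact φ.continuous.norm.aestronglyMeasurable
  · filter_upwards [hne] with x hx
    have h0 : 0 < ‖x‖ := norm_pos_iff.2 hx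
    rw [norm_of_nonneg (by positivity)]
    simp only [Pi.add_apply]
    rcases lt_or_ge ‖x‖ 1 with h | h
    · rw [indicator_of_mem (show ‖x‖ ∈ Ioo (0 : ℝ) 1 from ⟨h0, h⟩), mul_comm]
      have := mul_le_mul_of_nonneg_right (hφ x) (by positivity : 0 ≤ ‖x‖ ^ (-a))
      linarith [norm_nonneg (φ x)]
    · rw [indicator_of_notMem (by simp [h])]
      have := mul_le_mul_of_nonneg_right (rpow_le_one_of_one_le_of_nonpos h (neg_nonpos.2 ha0))
        (norm_nonneg (φ x))
      linarith

theorem integrable_norm_rpow_neg_mul_coord_pow_mul_schwartz {a : ℝ} (ha0 : 0 ≤ a) (ha : a < 2)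
    (i : Fin 2) (k : ℕ) (φ : 𝓢(EuclideanSpace ℝ (Fin 2), ℂ)) :
    Integrable fun x => ((‖x‖ ^ (-(k + a)) : ℝ) : ℂ) * (((x i ^ k : ℝ) : ℂ) * φ x) := by
  have hne : ∀ᵐ x : EuclideanSpace ℝ (Fin 2), x ≠ 0 := by simp [ae_iff]
  refine (integrable_norm_rpow_neg_mul_schwartz ha0 ha φ).mono' ?_ ?_
  · refine AEStronglyMeasurable.mul (Measurable.aestronglyMeasurable (by fun_prop)) ?_
    exact Continuous.aestronglyMeasurable (by fun_prop)
  · filter_upwards [hne] with x hx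
    have h0 : 0 < ‖x‖ := norm_pos_iff.2 hx
    rw [norm_mul, norm_mul, Complex.norm_real, Complex.norm_real, norm_pow,
      norm_of_nonneg (by positivity : 0 ≤ ‖x‖ ^ (-(k + a))), ← mul_assoc]
    gcongr
    calc ‖x‖ ^ (-(k + a)) * ‖x i‖ ^ k ≤ ‖x‖ ^ (-(k + a)) * ‖x‖ ^ k := by
          gcongr; exact PiLp.norm_apply_le x i
      _ = ‖x‖ ^ (-a) := by
          rw [← rpow_natCast, ← rpow_add h0]; ring_nf

theorem integrable_polynomial_mul_gaussian_mul_schwartz {u : ℝ} (hu : 0 ≤ u) (b : ℝ) (i : Fin 2)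
    (P : Polynomial ℝ) (φ : 𝓢(EuclideanSpace ℝ (Fin 2), ℂ)) :
    Integrable fun x => ((P.eval (b * x i) * exp (-(π * u * ‖x‖ ^ 2)) : ℝ) : ℂ) * φ x := by
  induction P using Polynomial.induction_on' with
  | add P Q hP hQ =>
    refine (hP.add hQ).congr (Filter.Eventually.of_forall fun x => ?_)
    simp only [Pi.add_apply, Polynomial.eval_add]
    push_cast
    ring
  | monomial k c =>
    refine ((φ.integrable_pow_mul volume k).const_mul (|c| * |b| ^ k)).mono'
      (Continuous.aestronglyMeasurable (by fun_prop)) (Filter.Eventually.of_forall fun x => ?_)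
    rw [Polynomial.eval_monomial, norm_mul, Complex.norm_real, norm_mul, norm_mul, norm_pow,
      norm_mul, norm_of_nonneg (exp_pos _).le, mul_pow, norm_eq_abs, norm_eq_abs b]
    have h1 : exp (-(π * u * ‖x‖ ^ 2)) ≤ 1 := exp_le_one_iff.2 (by
      have : 0 ≤ π * u * ‖x‖ ^ 2 := by positivity
      linarith)
    calc |c| * (|b| ^ k * ‖x i‖ ^ k) * exp (-(π * u * ‖x‖ ^ 2)) * ‖φ x‖
        ≤ |c| * (|b| ^ k * ‖x‖ ^ k) * 1 * ‖φ x‖ := by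
          gcongr; exact PiLp.norm_apply_le x i
      _ = _ := by ring

theorem hasLineDerivAt_hermite_mul_gaussian {b u : ℝ} (hb : b * b = 2 * π * u) (i : Fin 2) (m : ℕ)
    (x : EuclideanSpace ℝ (Fin 2)) :
    HasLineDerivAt ℝ (fun y : EuclideanSpace ℝ (Fin 2) =>
        ((((Polynomial.hermite m).map (Int.castRingHom ℝ)).eval (b * y i) *
          exp (-(π * u * ‖y‖ ^ 2)) : ℝ) : ℂ))
      ((-b * (((Polynomial.hermite (m + 1)).map (Int.castRingHom ℝ)).eval (b * x i) *
          exp (-(π * u * ‖x‖ ^ 2))) : ℝ) : ℂ) x (EuclideanSpace.single i 1) := by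
  have hcoord : ∀ s : ℝ, (x + s • EuclideanSpace.single i (1 : ℝ)) i = x i + s := by
    intro s; simp
  have hnorm : ∀ s : ℝ, ‖x + s • EuclideanSpace.single i (1 : ℝ)‖ ^ 2 =
      ‖x‖ ^ 2 + 2 * s * x i + s ^ 2 := by
    intro s
    rw [norm_add_sq_real, inner_smul_right, norm_smul]
    simp [EuclideanSpace.inner_single_right]
    ring
  rw [HasLineDerivAt]
  simp only [hcoord, hnorm]
  refine HasDerivAt.ofReal_comp ?_
  set P := (Polynomial.hermite m).map (Int.castRingHom ℝ) with hP
  have h1 : HasDerivAt (fun s : ℝ => b * (x i + s)) b 0 := by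
    simpa using ((hasDerivAt_id (0 : ℝ)).const_add (x i)).const_mul b
  have h2 : HasDerivAt (fun s : ℝ => P.eval (b * (x i + s)))
      (P.derivative.eval (b * (x i + 0)) * b) 0 :=
    HasDerivAt.comp (h₂ := fun y => P.eval y) (0 : ℝ) (P.hasDerivAt (b * (x i + 0))) h1
  have h3 : HasDerivAt (fun s : ℝ => -(π * u * (‖x‖ ^ 2 + 2 * s * x i + s ^ 2)))
      (-(π * u * (2 * x i))) 0 := by
    have := (((((hasDerivAt_id (0 : ℝ)).const_mul 2).mul_const (x i)).const_add (‖x‖ ^ 2)).add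
      ((hasDerivAt_id (0 : ℝ)).pow 2)).const_mul (π * u) |>.neg
    simpa using! this
  refine (h2.mul h3.exp).congr_deriv ?_
  rw [Polynomial.hermite_succ]
  simp only [Polynomial.map_sub, Polynomial.map_mul, Polynomial.map_X, Polynomial.eval_sub,
    Polynomial.eval_mul, Polynomial.eval_X, ← Polynomial.derivative_map, ← hP, add_zero, mul_zero,
    zero_mul, ne_eq, OfNat.ofNat_ne_zero, not_false_eq_true, zero_pow]
  linear_combination (exp (-(π * u * ‖x‖ ^ 2)) * P.eval (b * x i) * x i) * hb

end Schwartz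

section GaussianFourier

open scoped SchwartzMap LineDeriv FourierTransform

theorem integral_gaussian_mul_fourier {t : ℝ} (ht : 0 < t)
    (φ : 𝓢(EuclideanSpace ℝ (Fin 2), ℂ)) :
    ∫ x, ((exp (-(π * t * ‖x‖ ^ 2)) : ℝ) : ℂ) * 𝓕 φ x =
      ((t⁻¹ : ℝ) : ℂ) * ∫ ξ, ((exp (-(π * t⁻¹ * ‖ξ‖ ^ 2)) : ℝ) : ℂ) * φ ξ := by
  have hre : 0 < ((π * t : ℝ) : ℂ).re := by rw [Complex.ofReal_re]; positivity
  have hgi : Integrable fun x : EuclideanSpace ℝ (Fin 2) =>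
      Complex.exp (-((π * t : ℝ) : ℂ) * ‖x‖ ^ 2) := by
    simpa using GaussianFourier.integrable_cexp_neg_mul_sq_norm_add hre 0
      (0 : EuclideanSpace ℝ (Fin 2))
  have h := VectorFourier.integral_bilin_fourierIntegral_eq_flip (.mul ℂ ℂ)
    (L := innerₗ (EuclideanSpace ℝ (Fin 2))) continuous_fourierChar continuous_inner
    (φ.integrable (μ := volume)) hgi
  have h' : ∫ x, 𝓕 (φ : EuclideanSpace ℝ (Fin 2) → ℂ) x *
      Complex.exp (-((π * t : ℝ) : ℂ) * ‖x‖ ^ 2) = ∫ x, φ x *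
        𝓕 (fun x : EuclideanSpace ℝ (Fin 2) => Complex.exp (-((π * t : ℝ) : ℂ) * ‖x‖ ^ 2)) x := by
    simpa using! h
  rw [← integral_const_mul]
  calc _ = ∫ x, 𝓕 (φ : EuclideanSpace ℝ (Fin 2) → ℂ) x *
      Complex.exp (-((π * t : ℝ) : ℂ) * ‖x‖ ^ 2) := by
        congr 1; ext x
        rw [SchwartzMap.fourier_coe]
        push_cast
        ring_nf
    _ = _ := by
        rw [h']
        congr 1; ext x
        rw [fourier_gaussian_innerProductSpace hre]
        have hπ : (π : ℂ) ≠ 0 := by exact_mod_cast pi_ne_zero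
        have ht' : (t : ℂ) ≠ 0 := by exact_mod_cast ht.ne'
        have e1 : -(π : ℂ) ^ 2 * ‖x‖ ^ 2 / ((π * t : ℝ) : ℂ) = -(π * (t : ℂ)⁻¹ * ‖x‖ ^ 2) := by
          push_cast; field_simp
        have e2 : (π : ℂ) / ((π * t : ℝ) : ℂ) = (t : ℂ)⁻¹ := by
          push_cast; field_simp
        rw [e1, e2]
        simp
        ring

theorem integral_mul_lineDerivOp_eq_neg {v : EuclideanSpace ℝ (Fin 2)}
    {f f' : EuclideanSpace ℝ (Fin 2) → ℂ} (φ : 𝓢(EuclideanSpace ℝ (Fin 2), ℂ))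
    (hf : ∀ x, HasLineDerivAt ℝ f (f' x) x v) (hf'φ : Integrable fun x => f' x * φ x)
    (hfφ' : Integrable fun x => f x * (∂_{v} φ) x) (hfφ : Integrable fun x => f x * φ x) :
    ∫ x, f x * (∂_{v} φ) x = -∫ x, f' x * φ x := by
  have hφ : ∀ x, HasLineDerivAt ℝ φ ((∂_{v} φ) x) x v := by
    intro x
    rw [SchwartzMap.lineDerivOp_apply]
    exact φ.differentiableAt.lineDifferentiableAt.hasLineDerivAt
  exact integral_bilinear_hasLineDerivAt_right_eq_neg_left_of_integrable
    (B := ContinuousLinearMap.mul ℝ ℂ) hf'φ hfφ' hfφ (fun x _ => hf x) (fun x _ => hφ x)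

theorem integral_gaussian_mul_coord_pow_mul_fourier {t b : ℝ} (ht : 0 < t)
    (hb : b * b = 2 * π * t⁻¹) (i : Fin 2) (m : ℕ) (φ : 𝓢(EuclideanSpace ℝ (Fin 2), ℂ)) :
    ∫ x, ((exp (-(π * t * ‖x‖ ^ 2)) : ℝ) : ℂ) * (((x i ^ m : ℝ) : ℂ) * 𝓕 φ x) =
      ((t⁻¹ : ℝ) : ℂ) * (b / (2 * π * Complex.I)) ^ m *
        ∫ ξ, ((((Polynomial.hermite m).map (Int.castRingHom ℝ)).eval (b * ξ i) *
          exp (-(π * t⁻¹ * ‖ξ‖ ^ 2)) : ℝ) : ℂ) * φ ξ := by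
  induction m generalizing φ with
  | zero => simpa using integral_gaussian_mul_fourier ht φ
  | succ m ih =>
    have hu : 0 ≤ t⁻¹ := by positivity
    have hI : (2 * π * Complex.I : ℂ) ≠ 0 := by
      simp [pi_ne_zero]
    set v : EuclideanSpace ℝ (Fin 2) := EuclideanSpace.single i 1 with hv
    have hder : ∀ x : EuclideanSpace ℝ (Fin 2),
        𝓕 (∂_{v} φ) x = (2 * π * Complex.I) * ((x i : ℂ) * 𝓕 φ x) := by
      intro x
      have hg : (inner ℝ · v : EuclideanSpace ℝ (Fin 2) → ℝ).HasTemperateGrowth := by fun_prop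
      rw [SchwartzMap.fourier_lineDerivOp_eq, smul_apply,
        SchwartzMap.smulLeftCLM_apply_apply hg]
      simp [hv, EuclideanSpace.inner_single_right]
    have hparts := integral_mul_lineDerivOp_eq_neg φ
      (fun x => hasLineDerivAt_hermite_mul_gaussian hb i m x)
      (((integrable_polynomial_mul_gaussian_mul_schwartz hu b i
        ((Polynomial.hermite (m + 1)).map (Int.castRingHom ℝ)) φ).const_mul
        ((-b : ℝ) : ℂ)).congr (Filter.Eventually.of_forall fun x => by
          simp only [Complex.ofReal_mul (-b), mul_assoc]))
      (integrable_polynomial_mul_gaussian_mul_schwartz hu b i _ (∂_{v} φ))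
      (integrable_polynomial_mul_gaussian_mul_schwartz hu b i _ φ)
    have hleft : ∫ x, ((exp (-(π * t * ‖x‖ ^ 2)) : ℝ) : ℂ) * (((x i ^ (m + 1) : ℝ) : ℂ) * 𝓕 φ x) =
        (2 * π * Complex.I)⁻¹ * ∫ x, ((exp (-(π * t * ‖x‖ ^ 2)) : ℝ) : ℂ) *
          (((x i ^ m : ℝ) : ℂ) * 𝓕 (∂_{v} φ) x) := by
      rw [← integral_const_mul]
      congr 1; ext x
      rw [hder]
      push_cast
      field_simp
      ring
    rw [hleft, ih (∂_{v} φ), hparts, ← integral_neg]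
    have hright : ∫ x, -(((-b * (((Polynomial.hermite (m + 1)).map (Int.castRingHom ℝ)).eval
        (b * x i) * exp (-(π * t⁻¹ * ‖x‖ ^ 2))) : ℝ) : ℂ) * φ x) =
        (b : ℂ) * ∫ x, ((((Polynomial.hermite (m + 1)).map (Int.castRingHom ℝ)).eval
        (b * x i) * exp (-(π * t⁻¹ * ‖x‖ ^ 2)) : ℝ) : ℂ) * φ x := by
      rw [← integral_const_mul]
      congr 1; ext x
      push_cast
      ring
    rw [hright]
    ring

theorem eval_hermite_odd (N : ℕ) (y : ℝ) :
    ((Polynomial.hermite (2 * N + 1)).map (Int.castRingHom ℝ)).eval y =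
      ∑ j ∈ Finset.range (N + 1),
        ((Polynomial.hermite (2 * N + 1)).coeff (2 * j + 1) : ℝ) * y ^ (2 * j + 1) := by
  have hpair : ∀ (g : ℕ → ℝ) (M : ℕ), ∑ k ∈ Finset.range (2 * M), g k =
      ∑ j ∈ Finset.range M, (g (2 * j) + g (2 * j + 1)) := by
    intro g M
    induction M with
    | zero => simp
    | succ M ih =>
      rw [Finset.sum_range_succ, ← ih, show 2 * (M + 1) = 2 * M + 1 + 1 by ring,
        Finset.sum_range_succ, Finset.sum_range_succ, add_assoc]
  have hdeg : ((Polynomial.hermite (2 * N + 1)).map (Int.castRingHom ℝ)).natDegree < 2 * (N + 1) :=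
    lt_of_le_of_lt Polynomial.natDegree_map_le (by rw [Polynomial.natDegree_hermite]; omega)
  rw [Polynomial.eval_eq_sum_range' hdeg, hpair]
  refine Finset.sum_congr rfl fun j _ => ?_
  rw [Polynomial.coeff_map, Polynomial.coeff_map,
    Polynomial.coeff_hermite_of_odd_add (n := 2 * N + 1) (k := 2 * j) (by exact ⟨N + j, by ring⟩)]
  simp

theorem integral_gaussian_mul_coord_odd_pow_mul_fourier {t : ℝ} (ht : 0 < t) (i : Fin 2) (N : ℕ)
    (φ : 𝓢(EuclideanSpace ℝ (Fin 2), ℂ)) :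
    ∫ x, ((exp (-(π * t * ‖x‖ ^ 2)) : ℝ) : ℂ) * (((x i ^ (2 * N + 1) : ℝ) : ℂ) * 𝓕 φ x) =
      ∑ j ∈ Finset.range (N + 1), ((2 * π * Complex.I) ^ (2 * N + 1))⁻¹ *
        ((((Polynomial.hermite (2 * N + 1)).coeff (2 * j + 1) : ℝ) * (2 * π) ^ (N + j + 1) *
          (t⁻¹) ^ (N + j + 2) : ℝ) : ℂ) *
        ∫ ξ, ((exp (-(π * t⁻¹ * ‖ξ‖ ^ 2)) : ℝ) : ℂ) * (((ξ i ^ (2 * j + 1) : ℝ) : ℂ) * φ ξ) := by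
  have hu : 0 ≤ t⁻¹ := by positivity
  have hb : √(2 * π * t⁻¹) * √(2 * π * t⁻¹) = 2 * π * t⁻¹ := mul_self_sqrt (by positivity)
  set b := √(2 * π * t⁻¹)
  have hint : ∀ j : ℕ, Integrable fun ξ : EuclideanSpace ℝ (Fin 2) =>
      ((exp (-(π * t⁻¹ * ‖ξ‖ ^ 2)) : ℝ) : ℂ) * (((ξ i ^ (2 * j + 1) : ℝ) : ℂ) * φ ξ) := by
    intro j
    refine (integrable_polynomial_mul_gaussian_mul_schwartz hu 1 i
      (Polynomial.X ^ (2 * j + 1)) φ).congr (Filter.Eventually.of_forall fun ξ => ?_)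
    simp only [Polynomial.eval_pow, Polynomial.eval_X, one_mul]
    push_cast
    ring
  rw [integral_gaussian_mul_coord_pow_mul_fourier ht hb]
  simp_rw [← integral_const_mul]
  rw [← integral_finsetSum _ fun j _ => (hint j).const_mul _]
  congr 1; ext ξ
  rw [eval_hermite_odd]
  push_cast
  rw [Finset.sum_mul, Finset.sum_mul, Finset.mul_sum]
  refine Finset.sum_congr rfl fun j _ => ?_
  have hbc : (b : ℂ) ^ (2 * N + 1) * (b : ℂ) ^ (2 * j + 1) =
      (2 * π) ^ (N + j + 1) * (t : ℂ)⁻¹ ^ (N + j + 1) := by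
    have hb' : (b : ℂ) * b = 2 * π * (t : ℂ)⁻¹ := by exact_mod_cast hb
    rw [← mul_pow, ← hb', ← pow_add, show 2 * N + 1 + (2 * j + 1) = 2 * (N + j + 1) by ring,
      pow_mul, sq]
  rw [div_pow, mul_pow (b : ℂ) (ξ i : ℂ), show N + j + 2 = N + j + 1 + 1 by ring,
    pow_succ (t : ℂ)⁻¹ (N + j + 1)]
  linear_combination ((t : ℂ)⁻¹ * ((2 * π * Complex.I) ^ (2 * N + 1))⁻¹ *
    ((Polynomial.hermite (2 * N + 1)).coeff (2 * j + 1) : ℂ) *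
    (ξ i : ℂ) ^ (2 * j + 1) * Complex.exp (-(π * (t : ℂ)⁻¹ * ‖ξ‖ ^ 2)) * φ ξ) * hbc

end GaussianFourier

section Homogeneous

open scoped SchwartzMap FourierTransform

theorem integral_coord_odd_pow_mul_norm_rpow_mul_fourier {α : ℝ} (hα0 : 0 < α) (hα1 : α < 1)
    (i : Fin 2) (N : ℕ) (φ : 𝓢(EuclideanSpace ℝ (Fin 2), ℂ)) :
    ((Gamma ((2 * N + 1 + α) / 2) * π ^ (-((2 * N + 1 + α) / 2)) : ℝ) : ℂ) *
        ∫ x, ((‖x‖ ^ (-(2 * N + 1 + α)) : ℝ) : ℂ) *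
          (((x i ^ (2 * N + 1) : ℝ) : ℂ) * 𝓕 φ x) =
      ((2 * π * Complex.I) ^ (2 * N + 1))⁻¹ *
        ((2 ^ (N + 1) * π ^ (N + 1) * π ^ (-((3 - α) / 2)) : ℝ) : ℂ) *
        ∑ j ∈ Finset.range (N + 1),
          ((((Polynomial.hermite (2 * N + 1)).coeff (2 * j + 1) : ℝ) * 2 ^ j *
            Gamma (j + (3 - α) / 2) : ℝ) : ℂ) *
          ∫ ξ, ((‖ξ‖ ^ (-(2 * j + 3 - α)) : ℝ) : ℂ) *
            (((ξ i ^ (2 * j + 1) : ℝ) : ℂ) * φ ξ) := by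
  set s : ℝ := (2 * N + 1 + α) / 2 with hs
  have hs0 : 0 < s := by positivity
  have hL := (integral_norm_rpow_mul_eq_gaussian_superposition hs0
    (f := fun x : EuclideanSpace ℝ (Fin 2) => ((x i ^ (2 * N + 1) : ℝ) : ℂ) * 𝓕 φ x)
    (by have := (𝓕 φ).continuous; fun_prop)
    (by
      have := integrable_norm_rpow_neg_mul_coord_pow_mul_schwartz hα0.le (by linarith) i
        (2 * N + 1) (𝓕 φ)
      rw [show 2 * s = ((2 * N + 1 : ℕ) : ℝ) + α by rw [hs]; push_cast; ring]
      exact this)).2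
  have hR : ∀ j : ℕ, _ := fun j =>
    integral_norm_rpow_mul_eq_gaussian_superposition (s := j + (3 - α) / 2)
      (by have : (0 : ℝ) ≤ j := j.cast_nonneg
          linarith)
      (f := fun x : EuclideanSpace ℝ (Fin 2) => ((x i ^ (2 * j + 1) : ℝ) : ℂ) * φ x)
      (by fun_prop)
      (by
        have := integrable_norm_rpow_neg_mul_coord_pow_mul_schwartz (a := 2 - α) (by linarith)
          (by linarith) i (2 * j + 1) φ
        rw [show 2 * (j + (3 - α) / 2) = ((2 * j + 1 : ℕ) : ℝ) + (2 - α) by push_cast; ring]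
        exact this)
  have hI : ∀ j : ℕ, _ := fun j => integrableOn_and_integral_comp_inv
    (γ := j + (3 - α) / 2) (F := fun u : ℝ =>
      ∫ x, ((exp (-(π * u * ‖x‖ ^ 2)) : ℝ) : ℂ) * (((x i ^ (2 * j + 1) : ℝ) : ℂ) * φ x)) (hR j).1
  rw [show -(2 * N + 1 + α) = -(2 * s) by rw [hs]; ring, ← hL]
  have hcongr : ∀ t ∈ Ioi (0 : ℝ), ((t ^ (s - 1) : ℝ) : ℂ) *
      ∫ x, ((exp (-(π * t * ‖x‖ ^ 2)) : ℝ) : ℂ) * (((x i ^ (2 * N + 1) : ℝ) : ℂ) * 𝓕 φ x) =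
      ∑ j ∈ Finset.range (N + 1), (((2 * π * Complex.I) ^ (2 * N + 1))⁻¹ *
        ((((Polynomial.hermite (2 * N + 1)).coeff (2 * j + 1) : ℝ) *
          (2 * π) ^ (N + j + 1) : ℝ) : ℂ)) *
        (((t ^ (-(j + (3 - α) / 2) - 1) : ℝ) : ℂ) *
          ∫ ξ, ((exp (-(π * t⁻¹ * ‖ξ‖ ^ 2)) : ℝ) : ℂ) *
            (((ξ i ^ (2 * j + 1) : ℝ) : ℂ) * φ ξ)) := by
    intro t ht
    have ht : 0 < t := ht
    rw [integral_gaussian_mul_coord_odd_pow_mul_fourier ht, Finset.mul_sum]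
    refine Finset.sum_congr rfl fun j _ => ?_
    have hpow : t ^ (-(j + (3 - α) / 2) - 1) = t ^ (s - 1) * (t⁻¹) ^ (N + j + 2) := by
      rw [inv_pow, ← rpow_natCast, ← rpow_neg ht.le, ← rpow_add ht, hs]
      congr 1
      push_cast
      ring
    rw [hpow]
    push_cast
    ring
  rw [setIntegral_congr_fun measurableSet_Ioi hcongr,
    integral_finsetSum _ fun j _ => (hI j).1.const_mul _, Finset.mul_sum]
  refine Finset.sum_congr rfl fun j _ => ?_
  rw [integral_const_mul, (hI j).2, (hR j).2,
    show -(2 * j + 3 - α) = -(2 * (j + (3 - α) / 2)) by ring]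
  have hpi : (2 * π) ^ (N + j + 1) * π ^ (-(j + (3 - α) / 2)) =
      2 ^ (N + 1) * π ^ (N + 1) * π ^ (-((3 - α) / 2)) * 2 ^ j := by
    rw [neg_add, rpow_add pi_pos, rpow_neg pi_pos.le, rpow_natCast, mul_pow,
      show N + j + 1 = N + 1 + j by ring, pow_add, pow_add π]
    field_simp
  have hpi' := congrArg ((↑) : ℝ → ℂ) hpi
  push_cast at hpi' ⊢
  linear_combination (((2 * π * Complex.I) ^ (2 * N + 1))⁻¹ *
    ((Polynomial.hermite (2 * N + 1)).coeff (2 * j + 1) : ℂ) *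
    (Gamma (j + (3 - α) / 2) : ℂ) * ∫ ξ, ((‖ξ‖ ^ (-(2 * (j + (3 - α) / 2))) : ℝ) : ℂ) *
            ((ξ i : ℂ) ^ (2 * j + 1) * φ ξ)) * hpi'

end Homogeneous

section Multiplier

/-- The polynomial factor of the Fourier transform of `x_i^{2N+1} / |x|^{2N+1+α}`. -/
noncomputable def kernelPolynomial (N : ℕ) (α : ℝ) (i : Fin 2) : MvPolynomial (Fin 2) ℝ :=
  ∑ j ∈ Finset.range (N + 1),
    MvPolynomial.C (((Polynomial.hermite (2 * N + 1)).coeff (2 * j + 1) : ℝ) * 2 ^ j *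
      Gamma (j + (3 - α) / 2)) * (MvPolynomial.X i ^ (2 * j) *
        (MvPolynomial.X 0 ^ 2 + MvPolynomial.X 1 ^ 2) ^ (N - j))

theorem kernelPolynomial_isHomogeneous (N : ℕ) (α : ℝ) (i : Fin 2) :
    (kernelPolynomial N α i).IsHomogeneous (2 * N) := by
  refine MvPolynomial.IsHomogeneous.sum _ _ _ fun j hj => ?_
  have hj : j ≤ N := by simpa [Nat.lt_succ_iff] using hj
  refine MvPolynomial.IsHomogeneous.C_mul ?_ _
  have h1 := (MvPolynomial.isHomogeneous_X ℝ i).pow (2 * j)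
  have h2 := (((MvPolynomial.isHomogeneous_X ℝ (0 : Fin 2)).pow 2).add
    ((MvPolynomial.isHomogeneous_X ℝ (1 : Fin 2)).pow 2)).pow (N - j)
  have h := h1.mul h2
  rwa [show 1 * (2 * j) + 1 * 2 * (N - j) = 2 * N by omega] at h

theorem eval_kernelPolynomial (N : ℕ) (α : ℝ) (i : Fin 2) (ξ : EuclideanSpace ℝ (Fin 2)) :
    MvPolynomial.eval (fun j => ξ j) (kernelPolynomial N α i) =
      ∑ j ∈ Finset.range (N + 1),
        ((Polynomial.hermite (2 * N + 1)).coeff (2 * j + 1) : ℝ) * 2 ^ j *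
          Gamma (j + (3 - α) / 2) * (ξ i ^ (2 * j) * (‖ξ‖ ^ 2) ^ (N - j)) := by
  rw [EuclideanSpace.real_norm_sq_eq, Fin.sum_univ_two]
  simp [kernelPolynomial]

theorem eval_kernelPolynomial_ne_zero (N : ℕ) {α : ℝ} (hα0 : 0 < α) (hα1 : α < 1) (i : Fin 2)
    {ξ : EuclideanSpace ℝ (Fin 2)} (hξ : ξ ≠ 0) :
    MvPolynomial.eval (fun j => ξ j) (kernelPolynomial N α i) ≠ 0 := by
  have hi : ξ i ^ 2 ≤ ‖ξ‖ ^ 2 := by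
    rw [← sq_abs (ξ i)]
    exact pow_le_pow_left₀ (abs_nonneg _) (PiLp.norm_apply_le ξ i) 2
  have hpos := sum_choose_Gamma_ratio_pos (a := α / 2) (b := (3 - α) / 2) (by linarith)
    (by linarith) N hi (by have := norm_pos_iff.2 hξ; positivity)
  have heq : MvPolynomial.eval (fun j => ξ j) (kernelPolynomial N α i) =
      (-1) ^ N * ((2 * N + 1).factorial * √π / (2 ^ (N + 1) * N.factorial)) *
        ∑ j ∈ Finset.range (N + 1), (-1 : ℝ) ^ j * N.choose j *
          (Gamma ((3 - α) / 2 + j) / Gamma ((3 - α) / 2 + j + α / 2)) *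
            (ξ i ^ 2) ^ j * (‖ξ‖ ^ 2) ^ (N - j) := by
    rw [eval_kernelPolynomial, Finset.mul_sum]
    refine Finset.sum_congr rfl fun j hj => ?_
    have hj : j ≤ N := by simpa [Nat.lt_succ_iff] using hj
    rw [coeff_hermite_odd_mul_two_pow hj, show (3 - α) / 2 + j + α / 2 = j + 3 / 2 by ring,
      add_comm ((3 - α) / 2) (j : ℝ), pow_mul]
    ring
  rw [heq]
  refine mul_ne_zero (mul_ne_zero (by simp) ?_) hpos.ne'
  have : 0 < √π := by positivity
  positivity

theorem coord_mul_eval_kernelPolynomial_div (N : ℕ) (α : ℝ) (i : Fin 2)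
    {ξ : EuclideanSpace ℝ (Fin 2)} (hξ : ξ ≠ 0) :
    ξ i * MvPolynomial.eval (fun j => ξ j) (kernelPolynomial N α i) /
        ‖ξ‖ ^ (2 * ((N + 1 : ℕ) : ℝ) + 1 - α) =
      ∑ j ∈ Finset.range (N + 1),
        ((Polynomial.hermite (2 * N + 1)).coeff (2 * j + 1) : ℝ) * 2 ^ j *
          Gamma (j + (3 - α) / 2) * (‖ξ‖ ^ (-(2 * j + 3 - α)) * ξ i ^ (2 * j + 1)) := by
  have h0 : 0 < ‖ξ‖ := norm_pos_iff.2 hξ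
  rw [eval_kernelPolynomial, div_eq_mul_inv, ← rpow_neg h0.le, Finset.mul_sum, Finset.sum_mul]
  refine Finset.sum_congr rfl fun j hj => ?_
  have hj : j ≤ N := by simpa [Nat.lt_succ_iff] using hj
  have hpow : ‖ξ‖ ^ (-(2 * j + 3 - α)) =
      (‖ξ‖ ^ 2) ^ (N - j) * ‖ξ‖ ^ (-(2 * ((N + 1 : ℕ) : ℝ) + 1 - α)) := by
    rw [← pow_mul, ← rpow_natCast, ← rpow_add h0]
    congr 1
    push_cast [Nat.cast_sub hj]
    ring
  rw [hpow]
  ring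

end Multiplier

/-- The Fourier transform of `K^i_{α,n}` (in the sense of tempered distributions) equals
`c ξ_i p(ξ₁,ξ₂)/|ξ|^{2n+1-α}` for a nonzero constant `c` and a homogeneous polynomial `p`
of degree `2n-2` with real coefficients not vanishing on `ℝ² \ {0}`. -/
theorem stmt7 (n : ℕ) (hn : 1 ≤ n) (α : ℝ) (hα0 : 0 < α) (hα1 : α < 1) (i : Fin 2) :
    ∃ c : ℂ, c ≠ 0 ∧
      ∃ p : MvPolynomial (Fin 2) ℝ, p.IsHomogeneous (2 * n - 2) ∧
        (∀ ξ : EuclideanSpace ℝ (Fin 2), ξ ≠ 0 →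
          MvPolynomial.eval (fun j => ξ j) p ≠ 0) ∧
        ∀ φ : SchwartzMap (EuclideanSpace ℝ (Fin 2)) ℂ,
          ∫ x : EuclideanSpace ℝ (Fin 2), (Kker 2 n α i x : ℂ) * 𝓕 (⇑φ) x =
            c * ∫ ξ : EuclideanSpace ℝ (Fin 2),
              ((ξ i * MvPolynomial.eval (fun j => ξ j) p /
                  ‖ξ‖ ^ (2 * (n : ℝ) + 1 - α) : ℝ) : ℂ) * φ ξ := by
  obtain ⟨N, rfl⟩ := Nat.exists_eq_add_of_le' hn
  have hM : ((Gamma ((2 * N + 1 + α) / 2) * π ^ (-((2 * N + 1 + α) / 2)) : ℝ) : ℂ) ≠ 0 := by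
    refine Complex.ofReal_ne_zero.2 (mul_ne_zero (Gamma_pos_of_pos (by positivity)).ne' ?_)
    exact (rpow_pos_of_pos pi_pos _).ne'
  have hκ : ((2 * π * Complex.I) ^ (2 * N + 1))⁻¹ *
      ((2 ^ (N + 1) * π ^ (N + 1) * π ^ (-((3 - α) / 2)) : ℝ) : ℂ) ≠ 0 := by
    refine mul_ne_zero (inv_ne_zero (pow_ne_zero _ (by simp [pi_ne_zero]))) ?_
    exact Complex.ofReal_ne_zero.2 (by positivity)
  refine ⟨_, mul_ne_zero (inv_ne_zero hM) hκ, kernelPolynomial N α i,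
    kernelPolynomial_isHomogeneous N α i,
    fun ξ hξ => eval_kernelPolynomial_ne_zero N hα0 hα1 i hξ, fun φ => ?_⟩
  have hne : ∀ᵐ x : EuclideanSpace ℝ (Fin 2), x ≠ 0 := by simp [ae_iff]
  have hleft : ∫ x, (Kker 2 (N + 1) α i x : ℂ) * 𝓕 (⇑φ) x =
      ∫ x, ((‖x‖ ^ (-(2 * N + 1 + α)) : ℝ) : ℂ) *
        (((x i ^ (2 * N + 1) : ℝ) : ℂ) * 𝓕 φ x) := by
    congr 1; ext x
    rw [Kker, SchwartzMap.fourier_coe, rpow_neg (norm_nonneg x),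
      show 2 * ((N + 1 : ℕ) : ℝ) - 1 + α = 2 * N + 1 + α by push_cast; ring,
      show 2 * (N + 1) - 1 = 2 * N + 1 by omega]
    push_cast
    ring
  have hint : ∀ j : ℕ, Integrable fun ξ : EuclideanSpace ℝ (Fin 2) =>
      ((‖ξ‖ ^ (-(2 * j + 3 - α)) : ℝ) : ℂ) * (((ξ i ^ (2 * j + 1) : ℝ) : ℂ) * φ ξ) := by
    intro j
    have := integrable_norm_rpow_neg_mul_coord_pow_mul_schwartz (a := 2 - α) (by linarith)
      (by linarith) i (2 * j + 1) φ
    rw [show 2 * j + 3 - α = ((2 * j + 1 : ℕ) : ℝ) + (2 - α) by push_cast; ring]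
    exact this
  have hright : ∫ ξ : EuclideanSpace ℝ (Fin 2),
      ((ξ i * MvPolynomial.eval (fun j => ξ j) (kernelPolynomial N α i) /
        ‖ξ‖ ^ (2 * ((N + 1 : ℕ) : ℝ) + 1 - α) : ℝ) : ℂ) * φ ξ =
      ∑ j ∈ Finset.range (N + 1),
        ((((Polynomial.hermite (2 * N + 1)).coeff (2 * j + 1) : ℝ) * 2 ^ j *
          Gamma (j + (3 - α) / 2) : ℝ) : ℂ) *
        ∫ ξ, ((‖ξ‖ ^ (-(2 * j + 3 - α)) : ℝ) : ℂ) *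
          (((ξ i ^ (2 * j + 1) : ℝ) : ℂ) * φ ξ) := by
    simp_rw [← integral_const_mul]
    rw [← integral_finsetSum _ fun j _ => (hint j).const_mul _]
    refine integral_congr_ae ?_
    filter_upwards [hne] with ξ hξ
    rw [coord_mul_eval_kernelPolynomial_div N α i hξ, Complex.ofReal_sum, Finset.sum_mul]
    refine Finset.sum_congr rfl fun j _ => ?_
    push_cast
    ring
  rw [hleft, hright, mul_assoc, ← integral_coord_odd_pow_mul_norm_rpow_mul_fourier hα0 hα1 i N φ,
    inv_mul_cancel_left₀ hM]
end

section
/- Let n ≥ 1 be an integer, 0 < α < 1, and set β = 2n−3+α. Then for every x = (x₁, x₂) ∈ ℝ²∖{0}: ∂₁^{2n−1}(|x|^β) = Σ_{k=0}^{n−1} C(2n−1, 2k) · ((2k)!/(2^k · k!)) · x₁^{2n−2k−1} · (Π_{j=0}^{2n−2−k} (β−2j)) · |x|^{β−2(2n−1−k)}, where ∂₁^{2n−1} denotes the (2n−1)-st partial derivative with respect to x₁ and C(2n−1, 2k) is the binomial coefficient. -/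
open scoped BigOperators

/-- The coefficient `C(m,2k) (2k)! / (2^k k!)`, the number of partial matchings with `k` edges on
`m` points. -/
noncomputable def matchingCoeff (m k : ℕ) : ℝ :=
  (m.choose (2 * k) : ℝ) * (((2 * k).factorial : ℝ) / (2 ^ k * (k.factorial : ℝ)))

lemma matchingCoeff_zero_right (m : ℕ) : matchingCoeff m 0 = 1 := by
  simp [matchingCoeff]

lemma matchingCoeff_eq_zero {m k : ℕ} (h : m < 2 * k) : matchingCoeff m k = 0 := by
  simp [matchingCoeff, Nat.choose_eq_zero_of_lt h]

lemma matchingCoeff_succ_succ (m k : ℕ) :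
    matchingCoeff (m + 1) (k + 1) =
      matchingCoeff m (k + 1) + ((m - 2 * k : ℕ) : ℝ) * matchingCoeff m k := by
  have h : (m.choose (2 * k + 1) : ℝ) * (2 * k + 1) =
      m.choose (2 * k) * ((m - 2 * k : ℕ) : ℝ) := by
    exact_mod_cast Nat.choose_succ_right_eq m (2 * k)
  have hk : (k.factorial : ℝ) ≠ 0 := by positivity
  have hk' : (k : ℝ) + 1 ≠ 0 := by positivity
  simp only [matchingCoeff, show 2 * (k + 1) = 2 * k + 1 + 1 by ring, Nat.choose_succ_succ' m,
    Nat.factorial_succ, pow_succ]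
  push_cast
  field_simp
  linear_combination (2 * (k : ℝ) + 2) * h

/-- The function `t ↦ (∏_{j < m-k} (β - 2j)) t^(m-2k) |(t, y)|^(β - 2(m-k))`. -/
noncomputable def normRpowTerm (β y : ℝ) (m k : ℕ) (t : ℝ) : ℝ :=
  t ^ (m - 2 * k) * (∏ j ∈ Finset.range (m - k), (β - 2 * (j : ℝ))) *
    Real.sqrt (t ^ 2 + y ^ 2) ^ (β - 2 * ((m : ℝ) - (k : ℝ)))

lemma hasDerivAt_sqrt_sq_add_sq_rpow (p y t : ℝ) (h : t ^ 2 + y ^ 2 ≠ 0) :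
    HasDerivAt (fun t : ℝ => Real.sqrt (t ^ 2 + y ^ 2) ^ p)
      (p * t * Real.sqrt (t ^ 2 + y ^ 2) ^ (p - 2)) t := by
  have hr : 0 < Real.sqrt (t ^ 2 + y ^ 2) :=
    Real.sqrt_pos.mpr (lt_of_le_of_ne (by positivity) h.symm)
  have h1 : HasDerivAt (fun t : ℝ => t ^ 2 + y ^ 2) (2 * t) t := by
    simpa using (hasDerivAt_pow 2 t).add_const (y ^ 2)
  convert (h1.sqrt h).rpow_const (p := p) (Or.inl hr.ne') using 1
  rw [show p - 1 = p - 2 + 1 by ring, Real.rpow_add hr, Real.rpow_one]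
  field_simp

lemma hasDerivAt_normRpowTerm (β y : ℝ) {m k : ℕ} (hk : 2 * k ≤ m) (t : ℝ)
    (h : t ^ 2 + y ^ 2 ≠ 0) :
    HasDerivAt (normRpowTerm β y m k)
      (((m - 2 * k : ℕ) : ℝ) * normRpowTerm β y (m + 1) (k + 1) t +
        normRpowTerm β y (m + 1) k t) t := by
  have h1 := ((hasDerivAt_pow (m - 2 * k) t).mul_const
    (∏ j ∈ Finset.range (m - k), (β - 2 * (j : ℝ)))).mul
      (hasDerivAt_sqrt_sq_add_sq_rpow (β - 2 * ((m : ℝ) - (k : ℝ))) y t h)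
  refine h1.congr_deriv ?_
  simp only [normRpowTerm]
  rw [show m + 1 - 2 * (k + 1) = m - 2 * k - 1 by omega,
    show m + 1 - (k + 1) = m - k by omega,
    show m + 1 - 2 * k = m - 2 * k + 1 by omega,
    show m + 1 - k = m - k + 1 by omega, Finset.prod_range_succ,
    Nat.cast_sub (show k ≤ m by omega)]
  push_cast
  rw [show β - 2 * ((m : ℝ) + 1 - (k + 1)) = β - 2 * (m - k) by ring,
    show β - 2 * ((m : ℝ) + 1 - k) = β - 2 * (m - k) - 2 by ring]
  ring

/-- All derivatives of `t ↦ |(t, y)|^β` away from the origin. -/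
theorem iteratedDeriv_sqrt_sq_add_sq_rpow (β y : ℝ) (m : ℕ) (t : ℝ) (h : t ^ 2 + y ^ 2 ≠ 0) :
    iteratedDeriv m (fun t : ℝ => Real.sqrt (t ^ 2 + y ^ 2) ^ β) t =
      ∑ k ∈ Finset.range (m + 1), matchingCoeff m k * normRpowTerm β y m k t := by
  induction m generalizing t with
  | zero => simp [matchingCoeff, normRpowTerm]
  | succ m ih =>
    have hev : ∀ᶠ s in nhds t, s ^ 2 + y ^ 2 ≠ 0 :=
      ContinuousAt.eventually_ne (by fun_prop) h
    have hd : HasDerivAt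
        (fun s => ∑ k ∈ Finset.range (m + 1), matchingCoeff m k * normRpowTerm β y m k s)
        (∑ k ∈ Finset.range (m + 1), matchingCoeff m k *
          (((m - 2 * k : ℕ) : ℝ) * normRpowTerm β y (m + 1) (k + 1) t +
            normRpowTerm β y (m + 1) k t)) t := by
      refine HasDerivAt.fun_sum fun k _ => ?_
      rcases le_or_gt (2 * k) m with hk | hk
      · exact (hasDerivAt_normRpowTerm β y hk t h).const_mul _
      · simpa [matchingCoeff_eq_zero hk] using hasDerivAt_const t (0 : ℝ)
    have heq : iteratedDeriv m (fun t : ℝ => Real.sqrt (t ^ 2 + y ^ 2) ^ β) =ᶠ[nhds t]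
        fun s => ∑ k ∈ Finset.range (m + 1), matchingCoeff m k * normRpowTerm β y m k s :=
      hev.mono fun s hs => ih s hs
    rw [iteratedDeriv_succ, heq.deriv_eq, hd.deriv, Finset.sum_range_succ' _ (m + 1)]
    have hshift : ∑ k ∈ Finset.range (m + 1), matchingCoeff m k * normRpowTerm β y (m + 1) k t =
        ∑ k ∈ Finset.range (m + 1),
          matchingCoeff m (k + 1) * normRpowTerm β y (m + 1) (k + 1) t +
        matchingCoeff m 0 * normRpowTerm β y (m + 1) 0 t := by
      rw [← Finset.sum_range_succ' (fun k => matchingCoeff m k * normRpowTerm β y (m + 1) k t),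
        Finset.sum_range_succ _ (m + 1), matchingCoeff_eq_zero (show m < 2 * (m + 1) by omega)]
      ring
    simp only [mul_add, Finset.sum_add_distrib, matchingCoeff_succ_succ, add_mul, hshift,
      matchingCoeff_zero_right]
    simp only [mul_left_comm (matchingCoeff m _), mul_assoc]
    ring

/-- For `n ≥ 1`, `0 < α < 1`, `β = 2n - 3 + α`, and `(x₁, x₂) ≠ (0,0)`, the `(2n-1)`-st
partial derivative of `|x|^β` with respect to the first variable equals
`Σ_{k=0}^{n-1} C(2n-1,2k) ((2k)!/(2^k k!)) x₁^{2n-2k-1} (Π_{j=0}^{2n-2-k} (β-2j))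
|x|^{β-2(2n-1-k)}`. -/
theorem stmt8 (n : ℕ) (hn : 1 ≤ n) (α : ℝ) (hα0 : 0 < α) (hα1 : α < 1)
    (x₁ x₂ : ℝ) (hx : ¬(x₁ = 0 ∧ x₂ = 0)) :
    iteratedDeriv (2 * n - 1)
        (fun t : ℝ => Real.sqrt (t ^ 2 + x₂ ^ 2) ^ (2 * (n : ℝ) - 3 + α)) x₁ =
      ∑ k ∈ Finset.range n,
        ((2 * n - 1).choose (2 * k) : ℝ) * (((2 * k).factorial : ℝ) / (2 ^ k * (k.factorial : ℝ))) *
          x₁ ^ (2 * n - 2 * k - 1) *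
          (∏ j ∈ Finset.range (2 * n - 1 - k), (2 * (n : ℝ) - 3 + α - 2 * (j : ℝ))) *
          Real.sqrt (x₁ ^ 2 + x₂ ^ 2) ^
            (2 * (n : ℝ) - 3 + α - 2 * (2 * (n : ℝ) - 1 - (k : ℝ))) := by
  have h : x₁ ^ 2 + x₂ ^ 2 ≠ 0 := fun h0 =>
    hx ⟨by nlinarith [sq_nonneg x₁, sq_nonneg x₂], by nlinarith [sq_nonneg x₁, sq_nonneg x₂]⟩
  rw [iteratedDeriv_sqrt_sq_add_sq_rpow _ _ _ _ h]
  symm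
  refine Finset.sum_subset_zero_on_sdiff (Finset.range_subset_range.mpr (by omega)) ?_ ?_
  · intro k hk
    simp only [Finset.mem_sdiff, Finset.mem_range] at hk
    rw [matchingCoeff_eq_zero (by omega), zero_mul]
  · intro k _
    rw [normRpowTerm, matchingCoeff, show 2 * n - 1 - 2 * k = 2 * n - 2 * k - 1 by omega,
      Nat.cast_sub (show 1 ≤ 2 * n by omega)]
    push_cast
    ring
end

section
/- For every integer n ≥ 1, every integer l with 0 ≤ l ≤ n−1, and every real α with 0 < α < 1, the quantity b_{2l} := Σ_{k=1}^{l+1} (−1)^k · (Π_{j=1}^{k} (2j−1−α)) / ((2k−1)! · 2^{n−k} · (l+1−k)! · (n−l−1)!) is strictly negative. Consequently the homogeneous polynomial p(x₁,x₂) = Σ_{l=0}^{n−1} b_{2l} · x₁^{2l} · x₂^{2(n−1−l)} of degree 2n−2 has all coefficients negative. -/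
open scoped BigOperators

/-- The Chu–Vandermonde identity `₂F₁(-l, a; c; 1) = (c - a)_l / (c)_l`. -/
theorem chu_vandermonde_prod (l : ℕ) (a c : ℝ) (hc : 0 < c) :
    ∑ i ∈ Finset.range (l + 1), ((l.choose i : ℕ) : ℝ) *
        ((-1) ^ i * ((∏ j ∈ Finset.range i, (a + j)) / ∏ j ∈ Finset.range i, (c + j))) =
      (∏ j ∈ Finset.range l, (c - a + j)) / ∏ j ∈ Finset.range l, (c + j) := by
  induction l generalizing a c with
  | zero => simp
  | succ l ih =>
    have shift (b : ℝ) (i : ℕ) : ∏ j ∈ Finset.range (i + 1), (b + (j : ℝ)) =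
        b * ∏ j ∈ Finset.range i, (b + 1 + (j : ℝ)) := by
      rw [Finset.prod_range_succ', mul_comm]
      simp only [Nat.cast_zero, add_zero, Nat.cast_succ, add_assoc, add_comm (1 : ℝ)]
    have pos (b : ℝ) (hb : 0 < b) : 0 < ∏ j ∈ Finset.range l, (b + (j : ℝ)) :=
      Finset.prod_pos fun j _ => by positivity
    have h := Finset.sum_choose_succ_mul
      (fun i _ => (-1) ^ i *
        ((∏ j ∈ Finset.range i, (a + j)) / ∏ j ∈ Finset.range i, (c + j))) l
    have h' : ∑ i ∈ Finset.range (l + 1), ((l.choose i : ℕ) : ℝ) * ((-1) ^ (i + 1) *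
        ((∏ j ∈ Finset.range (i + 1), (a + j)) / ∏ j ∈ Finset.range (i + 1), (c + j))) =
        -(a / c) * ((∏ j ∈ Finset.range l, (c - a + j)) /
          ∏ j ∈ Finset.range l, (c + 1 + j)) := by
      have e := ih (a + 1) (c + 1) (by linarith)
      rw [show c + 1 - (a + 1) = c - a by ring] at e
      rw [← e, Finset.mul_sum]
      refine Finset.sum_congr rfl fun i _ => ?_
      rw [shift, shift, pow_succ, mul_div_mul_comm]
      ring
    have hs := shift c l
    rw [Finset.prod_range_succ] at hs
    have h1 := (pos c hc).ne'
    have h2 := (pos (c + 1) (by linarith)).ne'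
    have hcl : c + l ≠ 0 := by positivity
    have hc0 := hc.ne'
    rw [h, ih a c hc, h', Finset.prod_range_succ, Finset.prod_range_succ]
    have h3 : ∏ j ∈ Finset.range l, (c + 1 + (j : ℝ)) =
        (∏ j ∈ Finset.range l, (c + (j : ℝ))) * (c + l) / c := by
      rw [hs]; field_simp
    rw [h3]
    field_simp
    ring

theorem prod_odd_sub_div_factorial (α : ℝ) (i : ℕ) :
    (∏ j ∈ Finset.Icc 1 (i + 1), (2 * (j : ℝ) - 1 - α)) / ((2 * i + 1).factorial : ℝ) =
      (1 - α) * ((∏ j ∈ Finset.range i, ((3 - α) / 2 + j)) /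
        ∏ j ∈ Finset.range i, ((3 / 2 : ℝ) + j)) / (2 ^ i * (i.factorial : ℝ)) := by
  induction i with
  | zero => norm_num
  | succ i ih =>
    have hpos : 0 < ∏ j ∈ Finset.range i, ((3 / 2 : ℝ) + j) :=
      Finset.prod_pos fun j _ => by positivity
    rw [Finset.prod_Icc_succ_top (by omega), Finset.prod_range_succ, Finset.prod_range_succ,
      show 2 * (i + 1) + 1 = (2 * i + 1) + 1 + 1 by ring, Nat.factorial_succ (2 * i + 1 + 1),
      Nat.factorial_succ (2 * i + 1), Nat.factorial_succ i]
    rw [div_eq_iff (by positivity)] at ih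
    rw [ih]
    push_cast
    field_simp
    ring

/-- The coefficients `b_{2l}` of the homogeneous polynomial appearing in the Fourier
transform of the kernel are strictly negative: for `n ≥ 1`, `0 ≤ l ≤ n-1`, `0 < α < 1`,
`b_{2l} = Σ_{k=1}^{l+1} (-1)^k (1-α)(3-α)⋯(2k-1-α) / ((2k-1)! 2^{n-k} (l+1-k)! (n-l-1)!) < 0`. -/
theorem stmt9 (n l : ℕ) (hn : 1 ≤ n) (hl : l < n) (α : ℝ) (hα0 : 0 < α) (hα1 : α < 1) :
    ∑ k ∈ Finset.Icc 1 (l + 1),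
        (-1 : ℝ) ^ k * (∏ j ∈ Finset.Icc 1 k, (2 * (j : ℝ) - 1 - α)) /
          (((2 * k - 1).factorial : ℝ) * 2 ^ (n - k) * ((l + 1 - k).factorial : ℝ) *
            ((n - l - 1).factorial : ℝ)) < 0 := by
  have key : ∑ k ∈ Finset.Icc 1 (l + 1),
        (-1 : ℝ) ^ k * (∏ j ∈ Finset.Icc 1 k, (2 * (j : ℝ) - 1 - α)) /
          (((2 * k - 1).factorial : ℝ) * 2 ^ (n - k) * ((l + 1 - k).factorial : ℝ) *
            ((n - l - 1).factorial : ℝ)) =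
      -((1 - α) / (2 ^ (n - 1) * (l.factorial : ℝ) * ((n - l - 1).factorial : ℝ))) *
        ((∏ j ∈ Finset.range l, ((3 / 2 : ℝ) - (3 - α) / 2 + j)) /
          ∏ j ∈ Finset.range l, ((3 / 2 : ℝ) + j)) := by
    rw [← chu_vandermonde_prod l ((3 - α) / 2) (3 / 2) (by norm_num), Finset.mul_sum,
      ← Finset.Ico_add_one_right_eq_Icc, Finset.sum_Ico_eq_sum_range]
    refine Finset.sum_congr rfl fun i hi => ?_
    have hil : i ≤ l := Nat.lt_succ_iff.mp (Finset.mem_range.mp hi)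
    have hprod := prod_odd_sub_div_factorial α i
    rw [div_eq_iff (by positivity)] at hprod
    have hpow : (2 : ℝ) ^ (n - 1) = 2 ^ (n - 1 - i) * 2 ^ i := by
      rw [← pow_add]; congr 1; omega
    rw [add_comm 1 i, hprod, show 2 * (i + 1) - 1 = 2 * i + 1 by omega,
      show l + 1 - (i + 1) = l - i by omega, show n - (i + 1) = n - 1 - i by omega,
      Nat.cast_choose ℝ hil, hpow, pow_succ]
    field_simp
  rw [key]
  have hnum : 0 < ∏ j ∈ Finset.range l, ((3 / 2 : ℝ) - (3 - α) / 2 + j) :=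
    Finset.prod_pos fun j _ => by
      have : (0 : ℝ) ≤ j := j.cast_nonneg
      linarith
  have hden : 0 < ∏ j ∈ Finset.range l, ((3 / 2 : ℝ) + j) :=
    Finset.prod_pos fun j _ => by positivity
  have hα : 0 < 1 - α := by linarith
  rw [neg_mul, neg_lt_zero]
  positivity
end

section
/- Let m be an odd positive integer and let B > 0. Then for every real r with 0 < r ≤ B one has (r − B)^m · (r^m − B^m) + r^m · B^m ≥ B^{2m}/2^m. -/
/-- For `m` an odd positive integer, `B > 0` and `0 < r ≤ B`:
`(r - B)^m (r^m - B^m) + r^m B^m ≥ B^{2m}/2^m`. -/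
theorem stmt11 (m : ℕ) (hodd : Odd m) (hm : 1 ≤ m) (B : ℝ) (hB : 0 < B)
    (r : ℝ) (hr0 : 0 < r) (hrB : r ≤ B) :
    B ^ (2 * m) / 2 ^ m ≤ (r - B) ^ m * (r ^ m - B ^ m) + r ^ m * B ^ m := by
  have hs0 : 0 ≤ B - r := sub_nonneg.2 hrB
  have hC : 0 ≤ B ^ m := by positivity
  have hp : 0 ≤ r ^ m := by positivity
  have hq : 0 ≤ (B - r) ^ m := pow_nonneg hs0 m
  have hpC : r ^ m ≤ B ^ m := pow_le_pow_left₀ hr0.le hrB m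
  have hqC : (B - r) ^ m ≤ B ^ m := pow_le_pow_left₀ hs0 (by linarith) m
  have hneg : (r - B) ^ m = -(B - r) ^ m := by
    rw [← hodd.neg_pow, neg_sub]
  have hlhs : B ^ (2 * m) / 2 ^ m = (B / 2) ^ m * B ^ m := by
    rw [div_pow, two_mul, pow_add]
    ring
  rw [hneg, hlhs]
  rcases le_total (B / 2) r with h | h
  · have hhalf : (B / 2) ^ m ≤ r ^ m := pow_le_pow_left₀ (by positivity) h m
    linarith [mul_le_mul_of_nonneg_right hhalf hC, mul_nonneg hq (sub_nonneg.2 hpC)]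
  · have hhalf : (B / 2) ^ m ≤ (B - r) ^ m :=
      pow_le_pow_left₀ (by positivity) (by linarith) m
    linarith [mul_le_mul_of_nonneg_right hhalf hC, mul_nonneg hp (sub_nonneg.2 hqC)]
end

section
/- Let m be an odd positive integer and let B > 0. Then for every real r with −B ≤ r < 0 one has (r + B)^m · (r^m + B^m) − r^m · B^m ≥ B^{2m}/2^m. -/
/-- For `m` an odd positive integer, `B > 0` and `-B ≤ r < 0`:
`(r + B)^m (r^m + B^m) - r^m B^m ≥ B^{2m}/2^m`. -/
theorem stmt12 (m : ℕ) (hodd : Odd m) (hm : 1 ≤ m) (B : ℝ) (hB : 0 < B)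
    (r : ℝ) (hr0 : r < 0) (hrB : -B ≤ r) :
    B ^ (2 * m) / 2 ^ m ≤ (r + B) ^ m * (r ^ m + B ^ m) - r ^ m * B ^ m := by
  obtain ⟨x, rfl⟩ : ∃ x, r = -x := ⟨-r, by ring⟩
  obtain ⟨y, hy⟩ : ∃ y, -x + B = y := ⟨_, rfl⟩
  have hx0 : 0 ≤ x := by linarith
  have hy0 : 0 ≤ y := by linarith
  have hlhs : B ^ (2 * m) / 2 ^ m = (B / 2) ^ m * B ^ m := by
    rw [two_mul, pow_add, div_pow]; ring
  rw [hlhs, hodd.neg_pow, hy]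
  have hxm : 0 ≤ x ^ m := pow_nonneg hx0 m
  have hym : 0 ≤ y ^ m := pow_nonneg hy0 m
  have hBm : 0 ≤ B ^ m := pow_nonneg hB.le m
  have hxB : x ^ m ≤ B ^ m := pow_le_pow_left₀ hx0 (by linarith) m
  have hyB : y ^ m ≤ B ^ m := pow_le_pow_left₀ hy0 (by linarith) m
  have hhalf : 0 ≤ B / 2 := by linarith
  rcases le_total (B / 2) x with h | h
  · have hpow : (B / 2) ^ m ≤ x ^ m := pow_le_pow_left₀ hhalf h m
    linarith [mul_le_mul_of_nonneg_right hpow hBm, mul_nonneg hym (sub_nonneg.2 hxB)]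
  · have hpow : (B / 2) ^ m ≤ y ^ m := pow_le_pow_left₀ hhalf (by linarith) m
    linarith [mul_le_mul_of_nonneg_right hpow hBm, mul_nonneg hxm (sub_nonneg.2 hyB)]
end
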